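/- arXiv:1011.3009 — 3 statements merged into one kernel-verified Lean document; each statement's English description precedes it below -/
import Mathlib

section
/- Let a ∈ I_1 with a ∉ F, let f ∈ F, and let M be a nonzero left I_1-module of finite length. Then the kernels and cokernels of the K-linear maps a_M : m ↦ a·m and (a+f)_M : m ↦ (a+f)·m on M are all finite-dimensional over K, and dim_K ker((a+f)_M) − dim_K coker((a+f)_M) = dim_K ker(a_M) − dim_K coker(a_M), i.e., the index of a_M is unchanged by adding an element of F. -/
set_option linter.unusedSectionVars false

open Polynomial

noncomputable section

variable (K : Type*) [Field K] [CharZero K]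

/-- Formal differentiation `∂` as a `K`-linear endomorphism of `K[x]`. -/
def derOp : Module.End K (Polynomial K) := Polynomial.derivative

/-- Multiplication by `x` as a `K`-linear endomorphism of `K[x]`. -/
def xOp : Module.End K (Polynomial K) := LinearMap.mulLeft K (Polynomial.X : Polynomial K)

/-- Integration `∫`: the unique `K`-linear map with `∫ xⁿ = xⁿ⁺¹/(n+1)`. -/
def intOp : Module.End K (Polynomial K) :=
  Polynomial.lsum fun n => ((n : K) + 1)⁻¹ • Polynomial.monomial (n + 1)

/-- The algebra `I₁` of polynomial integro-differential operators: the unital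
`K`-subalgebra of `End_K K[x]` generated by `X`, `∂` and `∫`. -/
def I1 : Subalgebra K (Module.End K (Polynomial K)) :=
  Algebra.adjoin K {xOp K, derOp K, intOp K}

/-- `H := ∂ ∘ X`. -/
def Hop : Module.End K (Polynomial K) := derOp K * xOp K

/-- `e_{ij} := ∫^i ∂^j - ∫^{i+1} ∂^{j+1}`. -/
def eOp (i j : ℕ) : Module.End K (Polynomial K) :=
  intOp K ^ i * derOp K ^ j - intOp K ^ (i + 1) * derOp K ^ (j + 1)

/-- `F`, the `K`-linear span of the `e_{ij}`. -/
def Fspan : Submodule K (Module.End K (Polynomial K)) :=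
  Submodule.span K (Set.range fun p : ℕ × ℕ => eOp K p.1 p.2)

lemma xOp_mem : xOp K ∈ I1 K := Algebra.subset_adjoin (by simp)
lemma derOp_mem : derOp K ∈ I1 K := Algebra.subset_adjoin (by simp)
lemma intOp_mem : intOp K ∈ I1 K := Algebra.subset_adjoin (by simp)
lemma Hop_mem : Hop K ∈ I1 K := mul_mem (derOp_mem K) (xOp_mem K)
lemma eOp_mem (i j : ℕ) : eOp K i j ∈ I1 K :=
  sub_mem (mul_mem (pow_mem (intOp_mem K) i) (pow_mem (derOp_mem K) j))
    (mul_mem (pow_mem (intOp_mem K) (i + 1)) (pow_mem (derOp_mem K) (j + 1)))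

/-- `H` as an element of `I₁`. -/
def HelI : I1 K := ⟨Hop K, Hop_mem K⟩
/-- `∂` as an element of `I₁`. -/
def DelI : I1 K := ⟨derOp K, derOp_mem K⟩
/-- `∫` as an element of `I₁`. -/
def IntI : I1 K := ⟨intOp K, intOp_mem K⟩

set_option synthInstance.maxHeartbeats 400000
set_option maxHeartbeats 1000000

/-- The action of `a ∈ I₁` on an `I₁`-module `M`, as a `K`-linear map `M → M`. -/
def actMap (M : Type*) [AddCommGroup M] [Module K M] [Module (I1 K) M]
    [IsScalarTower K (I1 K) M] (a : I1 K) : M →ₗ[K] M where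
  toFun m := a • m
  map_add' := smul_add a
  map_smul' c m := by
    simp only [RingHom.id_apply]
    rw [← algebraMap_smul (I1 K) c m, ← mul_smul, ← Algebra.commutes, mul_smul,
      algebraMap_smul]

section LinAlg
variable {K : Type*} [Field K] {M : Type*} [AddCommGroup M] [Module K M]

lemma exists_li_of_not_fd (h : ¬ FiniteDimensional K M) (d : ℕ) :
    ∃ v : Fin d → M, LinearIndependent K v := by
  have h1 : ¬ Module.rank K M < Cardinal.aleph0 := by
    rwa [Module.rank_lt_aleph0_iff]
  have h2 : (d : Cardinal) ≤ Module.rank K M := (Cardinal.natCast_le_aleph0).trans (not_lt.mp h1)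
  exact Module.le_rank_iff.mp h2

lemma fd_of_li_bound (d : ℕ) (h : ∀ v : Fin d → M, ¬ LinearIndependent K v) :
    FiniteDimensional K M := by
  by_contra hn
  obtain ⟨v, hv⟩ := exists_li_of_not_fd hn d
  exact h v hv

lemma finrank_split_ker (g : M →ₗ[K] M) (P : Submodule K M) [FiniteDimensional K P]
    [FiniteDimensional K (LinearMap.ker g)] :
    Module.finrank K P ≤ Module.finrank K (P.map g) + Module.finrank K (LinearMap.ker g) := by
  have h := LinearMap.finrank_range_add_finrank_ker (g.domRestrict P)
  rw [LinearMap.range_domRestrict] at h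
  have h2 : Module.finrank K (LinearMap.ker (g.domRestrict P)) ≤
      Module.finrank K (LinearMap.ker g) := by
    let φ : LinearMap.ker (g.domRestrict P) →ₗ[K] LinearMap.ker g :=
      LinearMap.codRestrict _ (P.subtype ∘ₗ (LinearMap.ker (g.domRestrict P)).subtype)
        (fun x => x.2)
    apply LinearMap.finrank_le_finrank_of_injective (f := φ)
    intro x y hxy
    have := congrArg Subtype.val hxy
    exact Subtype.ext (Subtype.ext this)
  omega

lemma coker_fd_of_growth (g : M →ₗ[K] M) (Mn : ℕ → Submodule K M) (mono : Monotone Mn)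
    (fd : ∀ n, FiniteDimensional K (Mn n)) (ex : ∀ y, ∃ n, y ∈ Mn n) (A B : ℕ)
    (bd : ∀ n, Module.finrank K (Mn n) ≤ A * n + B) (k : ℕ)
    (hg : ∀ n, ∀ y ∈ Mn n, g y ∈ Mn (n + k)) (hker : FiniteDimensional K (LinearMap.ker g)) :
    FiniteDimensional K (M ⧸ LinearMap.range g) := by
  by_contra hn
  set κ := Module.finrank K (LinearMap.ker g) with hκ
  obtain ⟨v, hv⟩ := exists_li_of_not_fd hn (A * k + κ + 1)
  choose u hu using fun i => (LinearMap.range g).mkQ_surjective (v i)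
  have hu' : (fun i => (LinearMap.range g).mkQ (u i)) = v := funext hu
  have hli : LinearIndependent K ((LinearMap.range g).mkQ ∘ u) := by
    rw [← hu'] at hv; exact hv
  have hliu : LinearIndependent K u := LinearIndependent.of_comp _ hli
  choose s hs using fun i => ex (u i)
  let S := Finset.univ.sup s
  have hS : ∀ i, u i ∈ Mn S := fun i => mono (Finset.le_sup (Finset.mem_univ i)) (hs i)
  let Y := Submodule.span K (Set.range u)
  have hY : Module.finrank K Y = A * k + κ + 1 := by
    rw [finrank_span_eq_card hliu]; simp
  have hYfd : FiniteDimensional K Y := FiniteDimensional.span_of_finite K (Set.finite_range u)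
  have hdis : Disjoint Y (LinearMap.range g) := by
    rw [Submodule.disjoint_def]
    intro y hy hy2
    obtain ⟨c, rfl⟩ := (Submodule.mem_span_range_iff_exists_fun K).mp hy
    have h0 : (LinearMap.range g).mkQ (∑ i, c i • u i) = 0 := by
      rw [Submodule.mkQ_apply, Submodule.Quotient.mk_eq_zero]; exact hy2
    rw [map_sum] at h0
    simp only [map_smul] at h0
    have := Fintype.linearIndependent_iff.mp hli c h0
    simp [this]
  have step : ∀ n, S ≤ n → Module.finrank K (Mn n) + (A * k + 1) ≤ Module.finrank K (Mn (n + k)) := by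
    intro n hn
    have h1 := finrank_split_ker g (Mn n)
    have h2 : Y ⊔ (Mn n).map g ≤ Mn (n + k) := by
      refine sup_le ?_ ?_
      · rw [Submodule.span_le]
        rintro _ ⟨i, rfl⟩
        exact mono (by omega) (hS i)
      · rintro _ ⟨y, hy, rfl⟩
        exact hg n y hy
    have h3 := Submodule.finrank_mono h2
    have h4 := Submodule.finrank_sup_add_finrank_inf_eq Y ((Mn n).map g)
    have h5 : Y ⊓ (Mn n).map g = ⊥ := by
      rw [← disjoint_iff]
      exact hdis.mono_right (LinearMap.map_le_range)
    rw [h5, finrank_bot] at h4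
    omega
  have iter : ∀ t, t * (A * k + 1) ≤ Module.finrank K (Mn (S + t * k)) := by
    intro t
    induction t with
    | zero => simp
    | succ t ih =>
      have := step (S + t * k) (by omega)
      rw [show S + t * k + k = S + (t + 1) * k by ring] at this
      rw [add_mul]; omega
  have h1 := iter (A * S + B + 1)
  have h2 := bd (S + (A * S + B + 1) * k)
  nlinarith

lemma index_core (g : M →ₗ[K] M) (W : Submodule K M) [FiniteDimensional K (M ⧸ W)]
    [FiniteDimensional K (LinearMap.ker g)] [FiniteDimensional K (M ⧸ LinearMap.range g)] :
    (Module.finrank K (LinearMap.ker g) : ℤ) - Module.finrank K (M ⧸ LinearMap.range g) =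
    Module.finrank K (LinearMap.ker g ⊓ W : Submodule K M) - Module.finrank K (M ⧸ W.map g)
     + Module.finrank K (M ⧸ W) := by
  -- (i)
  have h1 := LinearMap.finrank_range_add_finrank_ker (W.mkQ.domRestrict (LinearMap.ker g))
  rw [LinearMap.range_domRestrict] at h1
  have h1' : Module.finrank K (LinearMap.ker (W.mkQ.domRestrict (LinearMap.ker g))) =
      Module.finrank K (LinearMap.ker g ⊓ W : Submodule K M) := by
    rw [LinearMap.ker_domRestrict, Submodule.ker_mkQ]
    rw [← Submodule.map_comap_subtype]
    exact (Submodule.finrank_map_subtype_eq _ _).symm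
  have h2 := Submodule.finrank_quotient_add_finrank ((LinearMap.ker g).map W.mkQ)
  let N := W.map g
  have hN : N ≤ LinearMap.range g := LinearMap.map_le_range
  have e3 := (Submodule.quotientQuotientEquivQuotient N (LinearMap.range g) hN).finrank_eq
  have e4 := (LinearMap.quotKerEquivRange (N.mkQ ∘ₗ g)).finrank_eq
  have hk : LinearMap.ker (N.mkQ ∘ₗ g) = W ⊔ LinearMap.ker g := by
    rw [LinearMap.ker_comp, Submodule.ker_mkQ, Submodule.comap_map_eq]
  have hr : LinearMap.range (N.mkQ ∘ₗ g) = (LinearMap.range g).map N.mkQ := LinearMap.range_comp _ _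
  rw [hr, hk] at e4
  have e5 := (Submodule.quotientQuotientEquivQuotient W (W ⊔ LinearMap.ker g) le_sup_left).finrank_eq
  have e6 : (W ⊔ LinearMap.ker g).map W.mkQ = (LinearMap.ker g).map W.mkQ := by
    rw [Submodule.map_sup]; simp
  rw [e6] at e5
  have fdr : FiniteDimensional K ((LinearMap.range g).map N.mkQ) := by
    have e := (LinearMap.quotKerEquivRange (N.mkQ ∘ₗ g))
    rw [hr, hk] at e
    have : FiniteDimensional K (M ⧸ (W ⊔ LinearMap.ker g)) := 
      Module.Finite.of_surjective (Submodule.factor (le_sup_left : W ≤ W ⊔ LinearMap.ker g)) (Submodule.factor_surjective _)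
    exact Module.Finite.equiv e
  have fdq : FiniteDimensional K (M ⧸ N) := by
    have := Module.Finite.equiv (Submodule.quotientQuotientEquivQuotient N (LinearMap.range g) hN).symm
    exact Module.Finite.of_submodule_quotient ((LinearMap.range g).map N.mkQ)
  have h7 := Submodule.finrank_quotient_add_finrank ((LinearMap.range g).map N.mkQ)
  change _ = _ - (Module.finrank K (M ⧸ N) : ℤ) + _
  omega

lemma index_perturb (g g' : M →ₗ[K] M) (W : Submodule K M) [FiniteDimensional K (M ⧸ W)]
    (h : ∀ y ∈ W, g y = g' y)
    [FiniteDimensional K (LinearMap.ker g)] [FiniteDimensional K (M ⧸ LinearMap.range g)]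
    [FiniteDimensional K (LinearMap.ker g')] [FiniteDimensional K (M ⧸ LinearMap.range g')] :
    (Module.finrank K (LinearMap.ker g) : ℤ) - Module.finrank K (M ⧸ LinearMap.range g) =
    (Module.finrank K (LinearMap.ker g') : ℤ) - Module.finrank K (M ⧸ LinearMap.range g') := by
  rw [index_core g W, index_core g' W]
  have h1 : (LinearMap.ker g ⊓ W : Submodule K M) = LinearMap.ker g' ⊓ W := by
    ext y
    simp only [Submodule.mem_inf, LinearMap.mem_ker]
    constructor
    · rintro ⟨a, b⟩; exact ⟨by rw [← h y b, a], b⟩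
    · rintro ⟨a, b⟩; exact ⟨by rw [h y b, a], b⟩
  have h2 : W.map g = W.map g' := by
    ext y
    simp only [Submodule.mem_map]
    constructor
    · rintro ⟨a, b, rfl⟩; exact ⟨a, b, (h a b).symm⟩
    · rintro ⟨a, b, rfl⟩; exact ⟨a, b, (h a b)⟩
  rw [h1, h2]

/-- extension lemma -/
lemma fred_ext {N Q : Type*} [AddCommGroup N] [Module K N] [AddCommGroup Q] [Module K Q]
    (i : N →ₗ[K] M) (q : M →ₗ[K] Q) (hq : Function.Surjective q) (hiq : ∀ y, q y = 0 → ∃ x, i x = y)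
    (hinj : Function.Injective i)
    (gN : N →ₗ[K] N) (g : M →ₗ[K] M) (gQ : Q →ₗ[K] Q)
    (hN : ∀ x, g (i x) = i (gN x)) (hQ : ∀ y, q (g y) = gQ (q y))
    (k1 : FiniteDimensional K (LinearMap.ker gN)) (c1 : FiniteDimensional K (N ⧸ LinearMap.range gN))
    (k2 : FiniteDimensional K (LinearMap.ker gQ)) (c2 : FiniteDimensional K (Q ⧸ LinearMap.range gQ)) :
    FiniteDimensional K (LinearMap.ker g) ∧ FiniteDimensional K (M ⧸ LinearMap.range g) := by
  constructor
  · have f1 : ((LinearMap.ker g).map q).FG := by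
      have : (LinearMap.ker g).map q ≤ LinearMap.ker gQ := by
        rintro _ ⟨y, hy, rfl⟩
        have hy' : g y = 0 := hy
        rw [LinearMap.mem_ker, ← hQ, hy', map_zero]
      have := Submodule.finiteDimensional_of_le this
      exact (Submodule.fg_iff_finiteDimensional _).mpr this
    have f2 : (LinearMap.ker g ⊓ LinearMap.ker q).FG := by
      have : LinearMap.ker g ⊓ LinearMap.ker q ≤ (LinearMap.ker gN).map i := by
        rintro y ⟨hy1, hy2⟩
        obtain ⟨x, rfl⟩ := hiq y hy2
        refine ⟨x, ?_, rfl⟩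
        apply hinj
        have : g (i x) = 0 := hy1
        rw [← hN, this, map_zero]
      have := Submodule.finiteDimensional_of_le this
      exact (Submodule.fg_iff_finiteDimensional _).mpr this
    exact (Submodule.fg_iff_finiteDimensional _).mp (Submodule.fg_of_fg_map_of_fg_inf_ker q f1 f2)
  · let r := LinearMap.range g
    let φ : (M ⧸ r) →ₗ[K] (Q ⧸ LinearMap.range gQ) := r.mapQ (LinearMap.range gQ) q (by
      rintro _ ⟨y, rfl⟩
      exact ⟨q y, (hQ y).symm⟩)
    let ψ : (N ⧸ LinearMap.range gN) →ₗ[K] (M ⧸ r) := (LinearMap.range gN).mapQ r i (by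
      rintro _ ⟨y, rfl⟩
      exact ⟨i y, hN y⟩)
    have f1 : ((⊤ : Submodule K (M ⧸ r)).map φ).FG := 
      (Submodule.fg_iff_finiteDimensional _).mpr inferInstance
    have f2 : ((⊤ : Submodule K (M ⧸ r)) ⊓ LinearMap.ker φ).FG := by
      have : (⊤ : Submodule K (M ⧸ r)) ⊓ LinearMap.ker φ ≤ LinearMap.range ψ := by
        rintro y ⟨-, hy⟩
        obtain ⟨y, rfl⟩ := r.mkQ_surjective y
        have hy2 : (LinearMap.range gQ).mkQ (q y) = 0 := hy
        have hy3 : q y ∈ LinearMap.range gQ := by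
          simpa using hy2
        obtain ⟨z, hz⟩ := hy3
        obtain ⟨z, rfl⟩ := hq z
        obtain ⟨x, hx⟩ := hiq (y - g z) (by rw [map_sub, hQ, hz, sub_self])
        refine ⟨(LinearMap.range gN).mkQ x, ?_⟩
        change r.mkQ (i x) = _
        rw [hx, map_sub, sub_eq_self]
        simp [r]
      have := Submodule.finiteDimensional_of_le this
      exact (Submodule.fg_iff_finiteDimensional _).mpr this
    have := Submodule.fg_of_fg_map_of_fg_inf_ker φ f1 f2
    exact ⟨this⟩
end LinAlg

section Abs
variable {K : Type*} [Field K] [CharZero K] {M : Type*} [AddCommGroup M] [Module K M]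

lemma twist {T h : Module.End K M} {r : K} (hT : ∀ y, T (h y) = h (T y) + r • T y)
    (p : K[X]) (y : M) : T (aeval h p y) = aeval h (taylor r p) (T y) := by
  induction p using Polynomial.induction_on' generalizing y with
  | add p q hp hq => simp [hp, hq]
  | monomial n a =>
    induction n generalizing y with
    | zero => simp
    | succ n ih =>
      have e1 : (monomial (n+1) a : K[X]) = monomial n a * X := by simp
      rw [e1, taylor_mul, map_mul, map_mul, Module.End.mul_apply, ih]
      simp [hT]

structure Sys (h D J : Module.End K M) : Prop where
  DJ : ∀ y, D (J y) = y
  Dh : ∀ y, D (h y) = h (D y) + (1 : K) • D y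
  Jh : ∀ y, J (h y) = h (J y) + (-1 : K) • J y
  hE : ∀ y, h (y - J (D y)) = y - J (D y)

lemma twistD {h D J : Module.End K M} (S : Sys h D J) (n : ℕ) (y : M) :
    (D ^ n) (h y) = h ((D ^ n) y) + (n : K) • (D ^ n) y := by
  induction n generalizing y with
  | zero => simp
  | succ n ih =>
    rw [pow_succ, Module.End.mul_apply, Module.End.mul_apply, S.Dh, map_add, ih, map_smul,
      add_assoc, ← add_smul]
    push_cast; rfl

/-- evaluation of a formal difference operator at a vector -/
def ev (h D : Module.End K M) (m : M) : (ℕ →₀ K[X]) →ₗ[K] M :=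
  Finsupp.lsum K fun k => (LinearMap.applyₗ ((D ^ k) m)) ∘ₗ (aeval h).toLinearMap

lemma ev_apply (h D : Module.End K M) (m : M) (p : ℕ →₀ K[X]) :
    ev h D m p = p.sum fun k q => aeval h q ((D ^ k) m) := rfl

lemma ev_single (h D : Module.End K M) (m : M) (k : ℕ) (q : K[X]) :
    ev h D m (Finsupp.single k q) = aeval h q ((D ^ k) m) := by
  simp [ev_apply]

lemma ev_range (h D : Module.End K M) (m : M) (p : ℕ →₀ K[X]) (e : ℕ) (he : ∀ k ∈ p.support, k ≤ e) :
    ev h D m p = ∑ k ∈ Finset.range (e + 1), aeval h (p k) ((D ^ k) m) := by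
  rw [ev_apply]
  apply Finsupp.sum_of_support_subset
  · intro k hk; simp; exact he k hk
  · simp

lemma ev_D {h D J : Module.End K M} (S : Sys h D J) (m : M) (p) :
    ∃ p', D (ev h D m p) = ev h D m p' := by
  induction p using Finsupp.induction_linear with
  | zero => exact ⟨0, by simp⟩
  | add p q hp hq =>
    obtain ⟨p', hp⟩ := hp
    obtain ⟨q', hq⟩ := hq
    exact ⟨p' + q', by simp [hp, hq]⟩
  | single k q =>
    refine ⟨Finsupp.single (k+1) (taylor 1 q), ?_⟩
    rw [ev_single, ev_single, twist S.Dh, pow_succ', Module.End.mul_apply]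

lemma ev_h {h D : Module.End K M} (m : M) (r : K[X]) (p) :
    ∃ p', aeval h r (ev h D m p) = ev h D m p' := by
  induction p using Finsupp.induction_linear with
  | zero => exact ⟨0, by simp⟩
  | add p q hp hq =>
    obtain ⟨p', hp⟩ := hp
    obtain ⟨q', hq⟩ := hq
    exact ⟨p' + q', by simp [hp, hq]⟩
  | single k q =>
    refine ⟨Finsupp.single k (r * q), ?_⟩
    rw [ev_single, ev_single, map_mul, Module.End.mul_apply]

lemma ev_Dn {h D J : Module.End K M} (S : Sys h D J) (m : M) (n : ℕ) (p) :
    ∃ p', (D ^ n) (ev h D m p) = ev h D m p' := by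
  induction n with
  | zero => exact ⟨p, by simp⟩
  | succ n ih =>
    obtain ⟨p', hp⟩ := ih
    rw [pow_succ', Module.End.mul_apply, hp]
    exact ev_D S m p'

def DRep (h D : Module.End K M) (m y : M) : Prop := ∃ n p, (D ^ n) y = ev h D m p

lemma DRep.add {h D J : Module.End K M} (S : Sys h D J) {m y z : M} (hy : DRep h D m y)
    (hz : DRep h D m z) : DRep h D m (y + z) := by
  obtain ⟨n, p, hp⟩ := hy
  obtain ⟨n', p', hp'⟩ := hz
  obtain ⟨q, hq⟩ := ev_Dn S m n' p
  obtain ⟨q', hq'⟩ := ev_Dn S m n p'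
  refine ⟨n + n', q + q', ?_⟩
  rw [map_add, map_add, ← hq, ← hq', ← hp, ← hp', ← Module.End.mul_apply, ← Module.End.mul_apply,
    ← pow_add, ← pow_add, add_comm n' n]

lemma DRep.smul {h D : Module.End K M} {m y : M} (hy : DRep h D m y) (c : K) : DRep h D m (c • y) := by
  obtain ⟨n, p, hp⟩ := hy
  exact ⟨n, c • p, by simp [hp]⟩

lemma DRep.zero {h D : Module.End K M} {m : M} : DRep h D m 0 := ⟨0, 0, by simp⟩

lemma DRep.self {h D : Module.End K M} {m : M} : DRep h D m m :=
  ⟨0, Finsupp.single 0 1, by simp [ev_single]⟩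

lemma DRep.h {h D J : Module.End K M} (S : Sys h D J) {m y : M} (hy : DRep h D m y) : DRep h D m (h y) := by
  obtain ⟨n, p, hp⟩ := hy
  obtain ⟨q, hq⟩ := ev_h (h := h) (D := D) m X p
  refine ⟨n, q + (n : K) • p, ?_⟩
  rw [twistD S, hp, map_add, ← hq, map_smul]
  simp

lemma DRep.D {h D J : Module.End K M} (S : Sys h D J) {m y : M} (hy : DRep h D m y) : DRep h D m (D y) := by
  obtain ⟨n, p, hp⟩ := hy
  obtain ⟨q, hq⟩ := ev_D S m p
  refine ⟨n, q, ?_⟩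
  rw [← Module.End.mul_apply, ← pow_succ, pow_succ', Module.End.mul_apply, hp, hq]

lemma DRep.J {h D J : Module.End K M} (S : Sys h D J) {m y : M} (hy : DRep h D m y) : DRep h D m (J y) := by
  obtain ⟨n, p, hp⟩ := hy
  refine ⟨n + 1, p, ?_⟩
  rw [pow_succ, Module.End.mul_apply, S.DJ, hp]

/-- simplicity with respect to h, D, J -/
def Simp3 (h D J : Module.End K M) : Prop :=
  ∀ P : Submodule K M, P ≠ ⊥ → (∀ y ∈ P, h y ∈ P) → (∀ y ∈ P, D y ∈ P) → (∀ y ∈ P, J y ∈ P) → P = ⊤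

lemma exists_rel {h D J : Module.End K M} (S : Sys h D J) (hs : Simp3 h D J)
    (TF : ∀ q : K[X], q ≠ 0 → ∀ y, aeval h q y = 0 → y = 0) (m : M) (hm : m ≠ 0) :
    ∃ p : ℕ →₀ K[X], p ≠ 0 ∧ ev h D m p = 0 := by
  have hhm : h m ≠ 0 := by
    intro h0
    exact hm (TF X X_ne_zero m (by simpa using h0))
  let P : Submodule K M := 
    { carrier := {y | DRep h D (h m) y}
      zero_mem' := DRep.zero
      add_mem' := fun ha hb => DRep.add S ha hb
      smul_mem' := fun c y hy => DRep.smul hy c }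
  have hP : P = ⊤ := by
    apply hs
    · rw [Submodule.ne_bot_iff]
      exact ⟨h m, DRep.self, hhm⟩
    · exact fun y hy => DRep.h S hy
    · exact fun y hy => DRep.D S hy
    · exact fun y hy => DRep.J S hy
  have hmP : m ∈ P := by rw [hP]; trivial
  obtain ⟨n, p, hp⟩ : DRep h D (h m) m := hmP
  have key : ∀ p : ℕ →₀ K[X], ∃ p' : ℕ →₀ K[X], (∀ k, p' k = p k * (X + C (k : K))) ∧
      ev h D (h m) p = ev h D m p' := by
    intro p
    induction p using Finsupp.induction_linear with
    | zero => exact ⟨0, by simp⟩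
    | add p q hp hq =>
      obtain ⟨p', hp1, hp⟩ := hp
      obtain ⟨q', hq1, hq⟩ := hq
      exact ⟨p' + q', by simp [hp1, hq1, add_mul], by simp [hp, hq]⟩
    | single k q =>
      refine ⟨Finsupp.single k (q * (X + C (k : K))), ?_, ?_⟩
      · intro j
        by_cases hj : k = j
        · subst hj; simp
        · simp [Finsupp.single_eq_of_ne' hj]
      · rw [ev_single, ev_single, twistD S, map_mul, Module.End.mul_apply]
        simp [Nat.cast_smul_eq_nsmul]
  obtain ⟨p', hp1, hp2⟩ := key p
  refine ⟨p' - Finsupp.single n 1, ?_, ?_⟩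
  · intro h0
    have h1 := DFunLike.congr_fun h0 n
    simp only [Finsupp.coe_sub, Pi.sub_apply, Finsupp.single_eq_same, hp1, Finsupp.coe_zero,
      Pi.zero_apply, sub_eq_zero] at h1
    have h2 : IsUnit (X + C (n : K)) := IsUnit.of_mul_eq_one (p n) (by rw [mul_comm]; exact h1)
    have h3 := natDegree_eq_zero_of_isUnit h2
    rw [natDegree_X_add_C] at h3
    exact one_ne_zero h3
  · rw [map_sub, ← hp2, ← hp, ev_single]
    simp
end Abs

section Abs3
variable {K : Type*} [Field K] [CharZero K] {M : Type*} [AddCommGroup M] [Module K M]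

lemma aeval_swap (h : Module.End K M) (a b : K[X]) (y : M) :
    aeval h a (aeval h b y) = aeval h b (aeval h a y) := by
  rw [← Module.End.mul_apply, ← Module.End.mul_apply, ← map_mul, ← map_mul, mul_comm]

structure Filt (h D J : Module.End K M) (Mn : ℕ → Submodule K M) (A B : ℕ) : Prop where
  mono : Monotone Mn
  fd : ∀ n, FiniteDimensional K (Mn n)
  bd : ∀ n, Module.finrank K (Mn n) ≤ A * n + B
  hh : ∀ n, ∀ y ∈ Mn n, h y ∈ Mn (n + 1)
  hD : ∀ n, ∀ y ∈ Mn n, D y ∈ Mn (n + 1)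
  hJ : ∀ n, ∀ y ∈ Mn n, J y ∈ Mn (n + 1)
  ex : ∀ y, ∃ n, y ∈ Mn n

lemma Filt.pow_h {h D J : Module.End K M} {Mn : ℕ → Submodule K M} {A B : ℕ} (F : Filt h D J Mn A B)
    (i n : ℕ) (y : M) (hy : y ∈ Mn n) : (h ^ i) y ∈ Mn (n + i) := by
  induction i with
  | zero => simpa
  | succ i ih => rw [pow_succ', Module.End.mul_apply, ← add_assoc]; exact F.hh _ _ ih

lemma Filt.pow_D {h D J : Module.End K M} {Mn : ℕ → Submodule K M} {A B : ℕ} (F : Filt h D J Mn A B)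
    (i n : ℕ) (y : M) (hy : y ∈ Mn n) : (D ^ i) y ∈ Mn (n + i) := by
  induction i with
  | zero => simpa
  | succ i ih => rw [pow_succ', Module.End.mul_apply, ← add_assoc]; exact F.hD _ _ ih

lemma Filt.aeval_h {h D J : Module.End K M} {Mn : ℕ → Submodule K M} {A B : ℕ} (F : Filt h D J Mn A B)
    (q : K[X]) (N n : ℕ) (hq : q.natDegree ≤ N) (y : M) (hy : y ∈ Mn n) : aeval h q y ∈ Mn (n + N) := by
  rw [aeval_eq_sum_range, LinearMap.sum_apply]
  refine Submodule.sum_mem _ fun i hi => ?_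
  rw [LinearMap.smul_apply]
  refine Submodule.smul_mem _ _ (F.mono ?_ (F.pow_h i n y hy))
  have := Finset.mem_range.mp hi
  omega

lemma taylor_sub_natDegree_lt (q : K[X]) (r : K) (hq : q.natDegree ≠ 0) :
    (taylor r q - q).natDegree < q.natDegree := by
  have hd : (taylor r q).degree = q.degree := degree_taylor q r
  have q0 : q ≠ 0 := by rintro rfl; simp at hq
  have := degree_sub_lt_left hd (by rw [Ne, taylor_eq_zero]; exact q0) (leadingCoeff_taylor r q)
  rw [hd] at this
  by_cases hz : taylor r q - q = 0
  · rw [hz]; simp; omega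
  · exact natDegree_lt_natDegree hz this

lemma taylor_neg_one_eq (q : K[X]) (hq : taylor (-1 : K) q = q) : q.natDegree = 0 := by
  -- q(x) = q(0) for all naturals
  have h1 : ∀ n : ℕ, q.eval (-(n : K)) = q.eval 0 := by
    intro n
    induction n with
    | zero => simp
    | succ n ih =>
      rw [← ih]
      conv_rhs => rw [← hq, taylor_eval]
      push_cast; congr 1; ring
  have h2 : q = C (q.eval 0) := by
    apply eq_of_infinite_eval_eq
    apply Set.infinite_of_injective_forall_mem (f := fun n : ℕ => -(n : K))
    · intro a b hab; simpa using hab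
    · intro n; simp [h1 n]
  rw [h2]; simp

lemma descent {d : ℕ} (R : (Fin d → K[X]) → Prop)
    (hR : ∀ c, R c → R (fun j => taylor (-1 : K) (c j) - c j))
    (hconst : ∀ l : Fin d → K, R (fun j => C (l j)) → l = 0) :
    ∀ (n : ℕ) (c : Fin d → K[X]), ∑ j, (c j).natDegree ≤ n → R c → c = 0 := by
  have base : ∀ c : Fin d → K[X], (∀ j, (c j).natDegree = 0) → R c → c = 0 := by
    intro c hc hRc
    have : c = fun j => C ((c j).coeff 0) := funext fun j => eq_C_of_natDegree_eq_zero (hc j)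
    rw [this] at hRc
    have h2 := hconst _ hRc
    rw [this]
    funext j
    have := congrFun h2 j
    have h3 : (c j).coeff 0 = 0 := this
    simp [h3]
  intro n
  induction n with
  | zero =>
    intro c hc hRc
    refine base c (fun j => ?_) hRc
    have := Finset.sum_eq_zero_iff.mp (Nat.le_zero.mp hc) j (Finset.mem_univ j)
    exact this
  | succ n ih =>
    intro c hc hRc
    by_cases hall : ∀ j, (c j).natDegree = 0
    · exact base c hall hRc
    · push Not at hall
      obtain ⟨j0, hj0⟩ := hall
      have hlt : ∑ j, (taylor (-1 : K) (c j) - c j).natDegree < ∑ j, (c j).natDegree := by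
        apply Finset.sum_lt_sum
        · intro j _
          by_cases h : (c j).natDegree = 0
          · rw [eq_C_of_natDegree_eq_zero h]; simp
          · exact (taylor_sub_natDegree_lt _ _ h).le
        · exact ⟨j0, Finset.mem_univ _, taylor_sub_natDegree_lt _ _ hj0⟩
      have h0 := ih _ (by omega) (hR c hRc)
      have := congrFun h0 j0
      simp only [Pi.zero_apply, sub_eq_zero] at this
      exact absurd (taylor_neg_one_eq _ this) hj0

/-- kernel finiteness, torsion free case -/
lemma ker_fd_TF {h D J : Module.End K M} (S : Sys h D J) (JD : ∀ y, J (D y) = y)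
    {Mn : ℕ → Submodule K M} {A B : ℕ} (F : Filt h D J Mn A B)
    (TF : ∀ q : K[X], q ≠ 0 → ∀ y, aeval h q y = 0 → y = 0)
    (p : ℕ →₀ K[X]) (hp : p ≠ 0) (P : Submodule K M) (hP : ∀ y ∈ P, ev h D y p = 0) :
    FiniteDimensional K P := by
  obtain ⟨e, he, hmax⟩ : ∃ e, p e ≠ 0 ∧ ∀ k ∈ p.support, k ≤ e := by
    have hne : p.support.Nonempty := Finsupp.support_nonempty_iff.mpr hp
    refine ⟨p.support.max' hne, ?_, fun k hk => Finset.le_max' _ _ hk⟩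
    exact Finsupp.mem_support_iff.mp (Finset.max'_mem _ hne)
  apply fd_of_li_bound (e * A + 1)
  intro v0 hv0
  let v : Fin (e * A + 1) → M := fun j => (v0 j : M)
  have hv : LinearIndependent K v := hv0.map' P.subtype (Submodule.ker_subtype P)
  choose s hs using fun i => F.ex (v i)
  let s0 := Finset.univ.sup s
  have hS : ∀ i, v i ∈ Mn s0 := fun i => F.mono (Finset.le_sup (Finset.mem_univ i)) (hs i)
  let N := e * (A * (s0 + e) + B) + 1
  -- the relation
  obtain ⟨c, hc0, hc⟩ : ∃ c : Fin (e * A + 1) → K[X], c ≠ 0 ∧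
      ∀ i < e, ∑ j, aeval h (c j) ((D ^ i) (v j)) = 0 := by
    let φ : Fin e → (Fin (e * A + 1) → degreeLT K N) →ₗ[K] M := fun i =>
      ∑ j, (LinearMap.applyₗ ((D ^ (i : ℕ)) (v j))) ∘ₗ (aeval h).toLinearMap ∘ₗ
        (degreeLT K N).subtype ∘ₗ LinearMap.proj j
    have hφ : ∀ i c, φ i c = ∑ j, aeval h (c j : K[X]) ((D ^ (i : ℕ)) (v j)) := by
      intro i c
      simp [φ, LinearMap.sum_apply]
    have hφm : ∀ i c, φ i c ∈ Mn (s0 + e + N) := by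
      intro i c
      rw [hφ]
      refine Submodule.sum_mem _ fun j _ => ?_
      refine F.aeval_h _ N _ ?_ _ (F.mono ?_ (F.pow_D i s0 _ (hS j)))
      · have := mem_degreeLT.mp (c j).2
        exact natDegree_le_of_degree_le this.le
      · have := i.2; omega
    let Φ : (Fin (e * A + 1) → degreeLT K N) →ₗ[K] (Fin e → Mn (s0 + e + N)) :=
      LinearMap.pi fun i => LinearMap.codRestrict _ (φ i) (hφm i)
    have := F.fd (s0 + e + N)
    have hfr : Module.finrank K (degreeLT K N) = N := by
      rw [(degreeLTEquiv K N).finrank_eq]; simp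
    have hfd : FiniteDimensional K (degreeLT K N) := 
      Module.Finite.equiv (degreeLTEquiv K N).symm
    have hlt : Module.finrank K (Fin e → Mn (s0 + e + N)) <
        Module.finrank K (Fin (e * A + 1) → degreeLT K N) := by
      rw [Module.finrank_pi_fintype, Module.finrank_pi_fintype]
      simp only [Finset.sum_const, Finset.card_univ, Fintype.card_fin, smul_eq_mul, hfr]
      have h1 := Nat.mul_le_mul_left e (F.bd (s0 + e + N))
      refine lt_of_le_of_lt h1 ?_
      have hN : N = e * (A * (s0 + e) + B) + 1 := rfl
      have : e * (A * (s0 + e + N) + B) = e * A * N + e * (A * (s0 + e) + B) := by ring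
      rw [this, add_mul]
      omega
    have hker := LinearMap.ker_ne_bot_of_finrank_lt hlt (f := Φ)
    obtain ⟨c, hc, hc0⟩ := (Submodule.ne_bot_iff _).mp hker
    refine ⟨fun j => (c j : K[X]), ?_, ?_⟩
    · intro h0
      apply hc0
      funext j
      exact Subtype.ext (congrFun h0 j)
    · intro i hi
      rw [← hφ ⟨i, hi⟩ c]
      have h1 : Φ c = 0 := hc
      exact congrArg Subtype.val (congrFun h1 ⟨i, hi⟩)
  have hall : ∀ i, ∑ j, aeval h (c j) ((D ^ i) (v j)) = 0 := by
    intro i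
    induction i using Nat.strong_induction_on with
    | _ i ih =>
      by_cases hi : i < e
      · exact hc i hi
      obtain ⟨t, rfl⟩ := Nat.exists_eq_add_of_le (not_lt.mp hi)
      have h1 : ∀ j, ∑ k ∈ Finset.range (e + 1), aeval h (taylor (t : K) (p k)) ((D ^ (t + k)) (v j)) = 0 := by
        intro j
        have h2 := hP (v j) (v0 j).2
        rw [ev_range h D _ p e hmax] at h2
        have h3 := congrArg (D ^ t) h2
        rw [map_zero, map_sum] at h3
        rw [← h3]
        refine Finset.sum_congr rfl fun k _ => ?_
        rw [twist (twistD S t), pow_add, Module.End.mul_apply]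
      have h4 : ∑ k ∈ Finset.range (e + 1), aeval h (taylor (t : K) (p k))
          (∑ j, aeval h (c j) ((D ^ (t + k)) (v j))) = 0 := by
        have : ∑ j, aeval h (c j) (∑ k ∈ Finset.range (e + 1), aeval h (taylor (t : K) (p k)) ((D ^ (t + k)) (v j))) = 0 := by
          simp [h1]
        rw [← this]
        simp only [map_sum]
        rw [Finset.sum_comm]
        refine Finset.sum_congr rfl fun j _ => Finset.sum_congr rfl fun k _ => ?_
        exact aeval_swap h _ _ _
      rw [Finset.sum_range_succ, Finset.sum_eq_zero, zero_add, add_comm t e] at h4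
      · exact TF _ (by rw [Ne, taylor_eq_zero]; exact he) _ h4
      · intro k hk
        rw [ih (t + k) (by have := Finset.mem_range.mp hk; omega), map_zero]
  apply hc0
  refine descent (fun c => ∀ i, ∑ j, aeval h (c j) ((D ^ i) (v j)) = 0) ?_ ?_ _ c le_rfl hall
  · intro c hc i
    have h1 := congrArg J (hc (i + 1))
    rw [map_zero, map_sum] at h1
    simp only [map_sub, LinearMap.sub_apply, Finset.sum_sub_distrib, hc i, sub_zero]
    rw [← h1]
    refine Finset.sum_congr rfl fun j _ => ?_
    rw [twist S.Jh, pow_succ', Module.End.mul_apply, JD]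
  · intro l hl
    have h1 := hl 0
    simp at h1
    exact funext (Fintype.linearIndependent_iff.mp hv l h1)
end Abs3

section Abs4
variable {K : Type*} [Field K] [CharZero K] {M : Type*} [AddCommGroup M] [Module K M]

/-- span of `h^t u_i` for `i ∈ I`, `t < b` -/
def Box {ι : Type*} (h : Module.End K M) (u : ι → M) (I : Finset ι) (b : ℕ) : Submodule K M :=
  Submodule.span K ((fun x : ι × ℕ => (h ^ x.2) (u x.1)) '' ((I ×ˢ Finset.range b : Finset (ι × ℕ)) : Set (ι × ℕ)))

lemma Box_fd {ι : Type*} (h : Module.End K M) (u : ι → M) (I : Finset ι) (b : ℕ) :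
    FiniteDimensional K (Box h u I b) :=
  FiniteDimensional.span_of_finite K (Set.Finite.image _ (Finset.finite_toSet _))

lemma Box_finrank {ι : Type*} (h : Module.End K M) (u : ι → M) (I : Finset ι) (b : ℕ) :
    Module.finrank K (Box h u I b) ≤ I.card * b := by
  classical
  unfold Box
  rw [← Finset.coe_image]
  refine (finrank_span_finset_le_card _).trans (Finset.card_image_le.trans ?_)
  simp

lemma Box_mem {ι : Type*} (h : Module.End K M) (u : ι → M) (I : Finset ι) (b : ℕ) (q : K[X]) (i : ι)
    (hi : i ∈ I) (hq : q.degree < b) : aeval h q (u i) ∈ Box h u I b := by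
  by_cases hq0 : q = 0
  · simp [hq0]
  rw [aeval_eq_sum_range, LinearMap.sum_apply]
  refine Submodule.sum_mem _ fun t ht => ?_
  rw [LinearMap.smul_apply]
  refine Submodule.smul_mem _ _ (Submodule.subset_span ⟨(i, t), ?_, rfl⟩)
  have h1 := Finset.mem_range.mp ht
  have h2 := (natDegree_lt_iff_degree_lt hq0).mpr hq
  simp [hi]; omega

lemma Box_le {ι : Type*} {h : Module.End K M} {u : ι → M} {I : Finset ι} {b : ℕ} {P : Submodule K M}
    (hP : ∀ i ∈ I, ∀ t < b, (h ^ t) (u i) ∈ P) : Box h u I b ≤ P := by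
  unfold Box
  rw [Submodule.span_le]
  rintro _ ⟨⟨i, t⟩, hx, rfl⟩
  simp at hx
  exact hP i hx.1 t hx.2

lemma Box_mono {ι : Type*} {h : Module.End K M} {u : ι → M} {I I' : Finset ι} {b b' : ℕ} 
    (hI : I ⊆ I') (hb : b ≤ b') : Box h u I b ≤ Box h u I' b' := by
  apply Submodule.span_mono
  apply Set.image_mono
  intro x hx
  simp at hx ⊢
  exact ⟨hI hx.1, by omega⟩

lemma Box_sup_mem {ι : Type*} {h : Module.End K M} {u : ι → M} {I : Finset ι} {b b' : ℕ}
    {Q : Submodule K M} {y : M} (hb : b ≤ b') (hy : y ∈ Q ⊔ Box h u I b) : y ∈ Q ⊔ Box h u I b' := by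
  have h1 : Q ⊔ Box h u I b ≤ Q ⊔ Box h u I b' :=
    sup_le le_sup_left ((Box_mono (Finset.Subset.refl I) hb).trans le_sup_right)
  exact h1 hy

/-- one sided reduction -/
lemma reduce (h : Module.End K M) (u : ℕ → M) (e δ : ℕ) (c : ℕ → ℕ → K[X])
    (hδ : ∀ j k, (c j k).natDegree ≤ δ) (hne : ∀ j, c j e ≠ 0)
    (rel : ∀ j, ∑ k ∈ Finset.range (e + 1), aeval h (c j k) (u (j + k)) = 0) (n : ℕ) :
    ∀ i, i ≤ n → ∀ (d : ℕ) (q : K[X]), q.natDegree ≤ d →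
      aeval h q (u i) ∈ Box h u (Finset.range (n + 1)) δ ⊔ Box h u (Finset.range e) (d + i * δ + 1) := by
  intro i
  induction i using Nat.strong_induction_on with
  | _ i ih =>
    intro hi d q hq
    have hqd : q.degree < ((d + i * δ + 1 : ℕ) : WithBot ℕ) := by
      refine lt_of_le_of_lt degree_le_natDegree ?_
      exact_mod_cast (by nlinarith [Nat.zero_le (i * δ)])
    by_cases hie : i < e
    · exact Submodule.mem_sup_right (Box_mem h u _ _ q i (by simpa using hie) hqd)
    obtain ⟨j, rfl⟩ := Nat.exists_eq_add_of_le (not_lt.mp hie)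
    have hdiv := EuclideanDomain.div_add_mod q (c j e)
    rw [← hdiv, map_add, LinearMap.add_apply]
    refine Submodule.add_mem _ ?_ ?_
    · rw [mul_comm (c j e), map_mul, Module.End.mul_apply]
      have h1 := rel j
      rw [Finset.sum_range_succ, add_comm j e] at h1
      rw [eq_neg_of_add_eq_zero_right h1, map_neg, map_sum]
      refine Submodule.neg_mem _ (Submodule.sum_mem _ fun k hk => ?_)
      rw [← Module.End.mul_apply, ← map_mul]
      have hk := Finset.mem_range.mp hk
      have h2 := ih (j + k) (by omega) (by omega) (d + δ) (q / c j e * c j k) (by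
        refine natDegree_mul_le.trans ?_
        have h3 := hδ j k
        have h4 : (q / c j e).natDegree ≤ q.natDegree := by
          exact natDegree_le_natDegree (degree_div_le q _)
        omega)
      refine Box_sup_mem ?_ h2
      have : (j + k + 1) * δ ≤ (e + j) * δ := Nat.mul_le_mul_right _ (by omega)
      rw [add_mul, one_mul] at this
      omega
    · refine Submodule.mem_sup_left (Box_mem h u _ _ _ _ (by simp; omega) ?_)
      have h1 := EuclideanDomain.mod_lt q (hne j)
      have h2 : (q % c j e).degree < (c j e).degree := h1
      refine lt_of_lt_of_le h2 (degree_le_natDegree.trans ?_)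
      exact_mod_cast hδ j e

lemma filt_TF {h D J : Module.End K M} (S : Sys h D J) (hs : Simp3 h D J) (JD : ∀ y, J (D y) = y)
    (m : M) (hm : m ≠ 0) (p : ℕ →₀ K[X]) (hp : p ≠ 0) (hpm : ev h D m p = 0) :
    ∃ Mn A B, Filt h D J Mn A B := by
  -- bi-infinite orbit
  let U : (Module.End K M)ˣ := ⟨D, J, LinearMap.ext S.DJ, LinearMap.ext JD⟩
  let V : ℤ → Module.End K M := fun j => ((U ^ j : (Module.End K M)ˣ) : Module.End K M)
  have VD : ∀ j y, D (V j y) = V (j + 1) y := by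
    intro j y
    have : U ^ (j + 1) = U * U ^ j := by rw [add_comm, zpow_add, zpow_one]
    simp only [V, this]; rfl
  have VJ : ∀ j y, J (V j y) = V (j - 1) y := by
    intro j y
    have := VD (j - 1) y
    rw [sub_add_cancel] at this
    rw [← this, JD]
  have Vn : ∀ k : ℕ, V k = D ^ k := by
    intro k; simp [V, U]
  have V0 : ∀ y, V 0 y = y := by intro y; simp [V]
  have Vadd : ∀ i j y, V (i + j) y = V i (V j y) := by
    intro i j y; simp [V, zpow_add]
  have Vh : ∀ j y, V j (h y) = h (V j y) + (j : K) • V j y := by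
    intro j y
    induction j using Int.induction_on with
    | zero => simp [V0]
    | succ n ih => 
      rw [← VD, ih, map_add, S.Dh, map_smul, VD, add_assoc, ← add_smul]
      push_cast; rw [add_comm (1 : K)]
    | pred n ih =>
      rw [← VJ, ih, map_add, S.Jh, map_smul, VJ, add_assoc, ← add_smul]
      push_cast; rw [add_comm (-1 : K), ← sub_eq_add_neg]
  have hne : p.support.Nonempty := Finsupp.support_nonempty_iff.mpr hp
  obtain ⟨a, ha, hmin⟩ : ∃ a, p a ≠ 0 ∧ ∀ k ∈ p.support, a ≤ k :=
    ⟨p.support.min' hne, Finsupp.mem_support_iff.mp (Finset.min'_mem _ hne),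
      fun k hk => Finset.min'_le _ _ hk⟩
  obtain ⟨b, hb, hmax⟩ : ∃ e, p e ≠ 0 ∧ ∀ k ∈ p.support, k ≤ e := 
    ⟨p.support.max' hne, Finsupp.mem_support_iff.mp (Finset.max'_mem _ hne),
      fun k hk => Finset.le_max' _ _ hk⟩
  have hab : a ≤ b := hmin b (Finsupp.mem_support_iff.mpr hb)
  obtain ⟨e, rfl⟩ := Nat.exists_eq_add_of_le hab
  let r : ℕ → K[X] := fun k => p (a + k)
  let δ := (Finset.range (e + 1)).sup fun k => (r k).natDegree
  let u : ℤ → M := fun j => V (j + a) m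
  have uD : ∀ j, D (u j) = u (j + 1) := by
    intro j; simp only [u, VD]; congr 2; ring
  have uJ : ∀ j, J (u j) = u (j - 1) := by
    intro j; simp only [u, VJ]; congr 2; ring
  have rel0 : ∑ k ∈ Finset.range (e + 1), aeval h (r k) (u k) = 0 := by
    rw [← hpm, ev_range h D m p (a + e) hmax, show a + e + 1 = a + (e + 1) by ring,
      Finset.sum_range_add (fun k => aeval h (p k) ((D ^ k) m)) a (e + 1), Finset.sum_eq_zero (s := Finset.range a), zero_add]
    · refine Finset.sum_congr rfl fun k _ => ?_
      simp only [u, r]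
      rw [← Vn]; push_cast; rw [add_comm (k : ℤ)]
    · intro k hk
      have : p k = 0 := by
        by_contra h0
        have := hmin k (Finsupp.mem_support_iff.mpr h0)
        have := Finset.mem_range.mp hk
        omega
      simp [this]
  have rel : ∀ j : ℤ, ∑ k ∈ Finset.range (e + 1), aeval h (taylor (j : K) (r k)) (u (j + k)) = 0 := by
    intro j
    have h1 := congrArg (V j) rel0
    rw [map_zero, map_sum] at h1
    rw [← h1]
    refine Finset.sum_congr rfl fun k _ => ?_
    rw [twist (Vh j)]
    simp only [u]
    rw [← Vadd, add_assoc]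
  have hdeg : ∀ (j : K) k, k ≤ e → (taylor j (r k)).natDegree ≤ δ := by
    intro j k hk
    rw [natDegree_taylor]
    exact Finset.le_sup (f := fun k => (r k).natDegree) (Finset.mem_range.mpr (by omega))
  have red1 := reduce h (fun i : ℕ => u i) e δ
    (fun j k => if k ≤ e then taylor ((j : ℤ) : K) (r k) else 0)
    (by intro j k; split_ifs with hk
        · exact hdeg _ k hk
        · simp)
    (by intro j; simp only [le_refl, if_true]; rw [Ne, taylor_eq_zero]; exact hb)
    (by intro j
        rw [← rel j]
        refine Finset.sum_congr rfl fun k hk => ?_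
        have := Finset.mem_range.mp hk
        rw [if_pos (by omega)]; push_cast; rfl)
  have red2 := reduce h (fun i : ℕ => u ((e : ℤ) - 1 - i)) e δ
    (fun j k => if k ≤ e then taylor ((-1 - j : ℤ) : K) (r (e - k)) else 0)
    (by intro j k; split_ifs with hk
        · exact hdeg _ _ (by omega)
        · simp)
    (by intro j; simp only [le_refl, if_true]; rw [Ne, taylor_eq_zero, Nat.sub_self]; exact ha)
    (by intro j
        rw [← rel (-1 - j), ← Finset.sum_range_reflect]
        refine Finset.sum_congr rfl fun k hk => ?_
        have hk := Finset.mem_range.mp hk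
        rw [if_pos (by omega)]
        have e1 : e - (e + 1 - 1 - k) = k := by omega
        rw [e1]
        congr 2
        have e2 : e + 1 - 1 - k = e - k := by omega
        rw [e2]; push_cast [Nat.cast_sub (show k ≤ e by omega)]; ring)
  let I : ℕ → Finset ℤ := fun n => Finset.Icc (-(n : ℤ)) n
  have hImono : ∀ n n', n ≤ n' → I n ⊆ I n' := by
    intro n n' hn x hx
    simp only [I, Finset.mem_Icc] at hx ⊢
    omega
  let Mn : ℕ → Submodule K M := fun n => Box h u (I n) (n + 1)
  have mono : Monotone Mn := fun n n' hn => Box_mono (hImono n n' hn) (by omega)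
  have memMn : ∀ n j t T, j ∈ I n → t ≤ n → aeval h (taylor T (X ^ t : K[X])) (u j) ∈ Mn n := by
    intro n j t T hj ht
    refine Box_mem h u _ _ _ j hj ?_
    rw [degree_taylor, degree_X_pow]
    exact_mod_cast (by omega)
  have hh : ∀ n, ∀ y ∈ Mn n, h y ∈ Mn (n + 1) := by
    intro n
    suffices Mn n ≤ (Mn (n + 1)).comap h from fun y hy => this hy
    refine Box_le fun j hj t ht => ?_
    have := memMn (n + 1) j (t + 1) 0 (hImono n _ (by omega) hj) (by omega)
    rw [taylor_zero, map_pow, aeval_X, pow_succ'] at this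
    exact this
  have hD : ∀ n, ∀ y ∈ Mn n, D y ∈ Mn (n + 1) := by
    intro n
    suffices Mn n ≤ (Mn (n + 1)).comap D from fun y hy => this hy
    refine Box_le fun j hj t ht => ?_
    rw [Submodule.mem_comap, show h ^ t = aeval h (X ^ t : K[X]) by simp, twist S.Dh, uD]
    refine memMn _ _ _ _ ?_ (by omega)
    simp only [I, Finset.mem_Icc] at hj ⊢
    push_cast; omega
  have hJ : ∀ n, ∀ y ∈ Mn n, J y ∈ Mn (n + 1) := by
    intro n
    suffices Mn n ≤ (Mn (n + 1)).comap J from fun y hy => this hy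
    refine Box_le fun j hj t ht => ?_
    rw [Submodule.mem_comap, show h ^ t = aeval h (X ^ t : K[X]) by simp, twist S.Jh, uJ]
    refine memMn _ _ _ _ ?_ (by omega)
    simp only [I, Finset.mem_Icc] at hj ⊢
    push_cast; omega
  have u0 : u 0 ≠ 0 := by
    intro h0
    apply hm
    have : V (-(a : ℤ)) (V (0 + a) m) = 0 := by
      change V _ (u 0) = 0
      rw [h0, map_zero]
    rw [← Vadd] at this
    simpa [V0] using this
  have hex : ∀ y, ∃ n, y ∈ Mn n := by
    have hdir : Directed (· ≤ ·) Mn := mono.directed_le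
    have htop : (⨆ n, Mn n) = ⊤ := by
      apply hs
      · rw [Submodule.ne_bot_iff]
        refine ⟨u 0, (le_iSup Mn 0) ?_, u0⟩
        have := memMn 0 0 0 0 (by simp [I]) le_rfl
        simpa using this
      · intro y hy
        obtain ⟨n, hn⟩ := (Submodule.mem_iSup_of_directed _ hdir).mp hy
        exact (le_iSup Mn (n+1)) (hh n y hn)
      · intro y hy
        obtain ⟨n, hn⟩ := (Submodule.mem_iSup_of_directed _ hdir).mp hy
        exact (le_iSup Mn (n+1)) (hD n y hn)
      · intro y hy
        obtain ⟨n, hn⟩ := (Submodule.mem_iSup_of_directed _ hdir).mp hy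
        exact (le_iSup Mn (n+1)) (hJ n y hn)
    intro y
    have hy : y ∈ ⨆ n, Mn n := by rw [htop]; trivial
    exact (Submodule.mem_iSup_of_directed _ hdir).mp hy
  have fdM : ∀ n, FiniteDimensional K (Mn n) := fun n => Box_fd _ _ _ _
  refine ⟨Mn, 2 * (δ + e * (1 + δ)), δ + e + (e + 1) * δ + e * (e * δ + 1), mono, fdM, ?_, hh, hD, hJ, hex⟩
  intro n
  have hle : Mn n ≤ (Box h (fun i : ℕ => u i) (Finset.range (n + 1)) δ ⊔
      Box h (fun i : ℕ => u i) (Finset.range e) (n + n * δ + 1)) ⊔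
      (Box h (fun i : ℕ => u ((e : ℤ) - 1 - i)) (Finset.range (n + e + 1)) δ ⊔
      Box h (fun i : ℕ => u ((e : ℤ) - 1 - i)) (Finset.range e) (n + (n + e) * δ + 1)) := by
    refine Box_le fun j hj t ht => ?_
    simp only [I, Finset.mem_Icc] at hj
    rw [show h ^ t = aeval h (X ^ t : K[X]) by simp]
    rcases le_total 0 j with hj0 | hj0
    · obtain ⟨i, rfl⟩ := Int.eq_ofNat_of_zero_le hj0
      have hin : i ≤ n := by omega
      have h1 := red1 n i hin n (X ^ t) (by rw [natDegree_X_pow]; omega)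
      refine Submodule.mem_sup_left ?_
      refine Box_sup_mem ?_ h1
      have := Nat.mul_le_mul_right δ hin
      omega
    · obtain ⟨i, hi⟩ := Int.eq_ofNat_of_zero_le (show 0 ≤ (e : ℤ) - 1 - j + 1 by omega)
      by_cases hi0 : i = 0
      · -- e = 0 and j = 0
        have he0 : e = 0 := by omega
        have hj00 : j = ((0 : ℕ) : ℤ) := by omega
        rw [hj00]
        have h1 := red1 n 0 (by omega) n (X ^ t) (by rw [natDegree_X_pow]; omega)
        refine Submodule.mem_sup_left ?_
        refine Box_sup_mem ?_ h1
        have := Nat.mul_le_mul_right δ (Nat.zero_le n)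
        omega
      have hin : i - 1 ≤ n + e := by omega
      have h1 := red2 (n + e) (i - 1) hin n (X ^ t) (by rw [natDegree_X_pow]; omega)
      rw [show (e : ℤ) - 1 - ((i - 1 : ℕ) : ℤ) = j by omega] at h1
      refine Submodule.mem_sup_right ?_
      refine Box_sup_mem ?_ h1
      have := Nat.mul_le_mul_right δ hin
      omega
  have fd1 := Box_fd h (fun i : ℕ => u i) (Finset.range (n + 1)) δ
  have fd2 := Box_fd h (fun i : ℕ => u i) (Finset.range e) (n + n * δ + 1)
  have fd3 := Box_fd h (fun i : ℕ => u ((e : ℤ) - 1 - i)) (Finset.range (n + e + 1)) δ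
  have fd4 := Box_fd h (fun i : ℕ => u ((e : ℤ) - 1 - i)) (Finset.range e) (n + (n + e) * δ + 1)
  have b1 := Box_finrank h (fun i : ℕ => u i) (Finset.range (n + 1)) δ
  have b2 := Box_finrank h (fun i : ℕ => u i) (Finset.range e) (n + n * δ + 1)
  have b3 := Box_finrank h (fun i : ℕ => u ((e : ℤ) - 1 - i)) (Finset.range (n + e + 1)) δ
  have b4 := Box_finrank h (fun i : ℕ => u ((e : ℤ) - 1 - i)) (Finset.range e) (n + (n + e) * δ + 1)
  rw [Finset.card_range] at b1 b2 b3 b4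
  refine (Submodule.finrank_mono hle).trans ?_
  refine (Submodule.finrank_add_le_finrank_add_finrank _ _).trans ?_
  refine (add_le_add ((Submodule.finrank_add_le_finrank_add_finrank _ _).trans (add_le_add b1 b2))
    ((Submodule.finrank_add_le_finrank_add_finrank _ _).trans (add_le_add b3 b4))).trans ?_
  apply le_of_eq
  ring
end Abs4

section Abs5
variable {K : Type*} [Field K] [CharZero K] {M : Type*} [AddCommGroup M] [Module K M]

lemma bez {h : Module.End K M} {a b : K[X]} (hab : IsCoprime a b) {y : M}
    (ha : aeval h a y = 0) (hb : aeval h b y = 0) : y = 0 := by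
  obtain ⟨u, v, huv⟩ := hab
  have h1 : aeval h (u * a + v * b) y = 0 := by
    rw [map_add, map_mul, map_mul, LinearMap.add_apply, Module.End.mul_apply, Module.End.mul_apply,
      ha, hb, map_zero, map_zero, add_zero]
  rw [huv] at h1
  simpa using h1

/-- the shifted polynomial `p(x - i)` -/
def shp (p : K[X]) (i : ℤ) : K[X] := taylor (-(i : K)) p

lemma shp_zero (p : K[X]) : shp p 0 = p := by simp [shp]

lemma shp_monic {p : K[X]} (hm : p.Monic) (i : ℤ) : (shp p i).Monic := by
  unfold shp Monic
  rw [leadingCoeff_taylor]; exact hm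

lemma shp_irr {p : K[X]} (hp : Irreducible p) (i : ℤ) : Irreducible (shp p i) := by
  have := (MulEquiv.irreducible_iff (taylorEquiv (-(i : K))) (x := p)).mpr hp
  exact this

lemma shp_inj {p : K[X]} (hp : Irreducible p) {i j : ℤ} (h : shp p i = shp p j) : i = j := by
  by_contra hij
  have hij' : (j : K) - i ≠ 0 := by
    rw [sub_ne_zero]; exact fun h0 => hij (Int.cast_injective h0).symm
  have e1 : ∀ x : K, eval (x + ((j : K) - i)) p = eval x p := by
    intro x
    have := congrArg (eval (x + j)) h
    unfold shp at this
    rw [taylor_eval, taylor_eval] at this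
    rw [show x + ((j : K) - i) = x + j + -i by ring, this]
    congr 1; ring
  have e2 : ∀ n : ℕ, eval (n * ((j : K) - i)) p = eval 0 p := by
    intro n
    induction n with
    | zero => simp
    | succ n ih => rw [← ih, ← e1 (n * ((j : K) - i))]; congr 1; push_cast; ring
  have e3 : p = C (eval 0 p) := by
    apply eq_of_infinite_eval_eq
    apply Set.infinite_of_injective_forall_mem (f := fun n : ℕ => (n : K) * ((j : K) - i))
    · intro a b hab
      have := mul_right_cancel₀ hij' hab
      exact_mod_cast this
    · intro n
      simp only [Set.mem_ofPred_eq, eval_C]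
      exact e2 n
  have := hp.natDegree_pos
  rw [e3, natDegree_C] at this
  exact absurd this (lt_irrefl 0)

lemma shp_coprime {p : K[X]} (hp : Irreducible p) (hm : p.Monic) {i j : ℤ} (hij : i ≠ j) :
    IsCoprime (shp p i) (shp p j) := by
  rcases (shp_irr hp i).isCoprime_or_dvd (shp p j) with h | h
  · exact h
  · exfalso
    apply hij
    apply shp_inj hp
    apply eq_of_monic_of_associated (shp_monic hm i) (shp_monic hm j)
    exact associated_of_dvd_dvd h ((shp_irr hp i).dvd_symm (shp_irr hp j) h)

lemma shp_fin {p : K[X]} (hp : Irreducible p) (hm : p.Monic) (q : K[X]) (hq : q ≠ 0) :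
    ∃ n : ℕ, ∀ i : ℤ, n < |i| → IsCoprime (shp p i) q := by
  classical
  have hfin : {i : ℤ | ¬ IsCoprime (shp p i) q}.Finite := by
    apply Set.Finite.of_finite_image (f := shp p)
    · apply Set.Finite.subset (Finset.finite_toSet (UniqueFactorizationMonoid.normalizedFactors q).toFinset)
      rintro _ ⟨i, hi, rfl⟩
      simp only [Finset.mem_coe, Multiset.mem_toFinset]
      rw [UniqueFactorizationMonoid.mem_normalizedFactors_iff' hq]
      exact ⟨shp_irr hp i, (shp_monic hm i).normalize_eq_self,
        ((shp_irr hp i).isCoprime_or_dvd q).resolve_left hi⟩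
    · intro i _ j _ h
      exact shp_inj hp h
  refine ⟨hfin.toFinset.sup Int.natAbs, fun i hi => ?_⟩
  by_contra hc
  have : i.natAbs ≤ hfin.toFinset.sup Int.natAbs := 
    Finset.le_sup (f := Int.natAbs) (by simpa using hc)
  rw [Int.abs_eq_natAbs] at hi
  omega

structure Grad (h D J : Module.End K M) (p : K[X]) (W : ℤ → Submodule K M) (d : ℕ) : Prop where
  irr : Irreducible p
  mon : p.Monic
  kil : ∀ i, ∀ y ∈ W i, aeval h (shp p i) y = 0
  Wh : ∀ i, ∀ y ∈ W i, h y ∈ W i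
  WD : ∀ i, ∀ y ∈ W i, D y ∈ W (i - 1)
  WJ : ∀ i, ∀ y ∈ W i, J y ∈ W (i + 1)
  fd : ∀ i, FiniteDimensional K (W i)
  bd : ∀ i, Module.finrank K (W i) ≤ d
  ne : ∃ y ∈ W 0, y ≠ 0
  inj : ∀ i, i ≠ 0 → ∀ y ∈ W i, D y = 0 → y = 0

lemma exists_irr (h : Module.End K M) (q : K[X]) : q ≠ 0 → ∀ m : M, m ≠ 0 → aeval h q m = 0 →
    ∃ p : K[X], Irreducible p ∧ ∃ m' : M, m' ≠ 0 ∧ aeval h p m' = 0 := by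
  induction q using UniqueFactorizationMonoid.induction_on_prime with
  | h₁ => intro h0; exact absurd rfl h0
  | h₂ x hx =>
    intro _ m hm hxm
    exfalso; apply hm
    obtain ⟨u, hu⟩ := hx.exists_left_inv
    have : aeval h (u * x) m = 0 := by rw [map_mul, Module.End.mul_apply, hxm, map_zero]
    rw [hu] at this; simpa using this
  | h₃ a p ha hp ih =>
    intro _ m hm hpm
    by_cases h0 : aeval h a m = 0
    · exact ih ha m hm h0
    · exact ⟨p, hp.irreducible, aeval h a m, h0, by rwa [map_mul, Module.End.mul_apply] at hpm⟩

lemma mem_finsum {W : ℤ → Submodule K M} {s : Finset ℤ} {y : M} :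
    y ∈ (⨆ i ∈ s, W i) ↔ ∃ c : ℤ → M, (∀ i, c i ∈ W i) ∧ y = ∑ i ∈ s, c i := by
  rw [Submodule.mem_iSup_finset_iff_exists_sum]
  constructor
  · rintro ⟨μ, h⟩; exact ⟨fun i => μ i, fun i => (μ i).2, h.symm⟩
  · rintro ⟨c, hc, h⟩; exact ⟨fun i => ⟨c i, hc i⟩, h.symm⟩

lemma grad_of {h D J : Module.End K M} (S : Sys h D J) (p : K[X]) (hp : Irreducible p) (hmon : p.Monic)
    (m : M) (hm : m ≠ 0) (hpm : aeval h p m = 0)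
    (alt : (∀ y, D y = 0 → y = 0) ∨ (p = X - C 1 ∧ D m = 0)) :
    ∃ W d, Grad h D J p W d := by
  let L : K[X] →ₗ[K] M := (LinearMap.applyₗ m).comp (aeval h).toLinearMap
  have hL : ∀ q, L q = aeval h q m := fun q => rfl
  let V0 : Submodule K M := LinearMap.range L
  have memV : ∀ q, aeval h q m ∈ V0 := fun q => ⟨q, rfl⟩
  have V0h : ∀ y ∈ V0, h y ∈ V0 := by
    rintro _ ⟨q, rfl⟩
    refine ⟨X * q, ?_⟩
    rw [hL, hL, map_mul, aeval_X]; rfl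
  have V0p : ∀ y ∈ V0, aeval h p y = 0 := by
    rintro _ ⟨q, rfl⟩
    rw [hL, ← Module.End.mul_apply, ← map_mul, mul_comm, map_mul, Module.End.mul_apply, hpm, map_zero]
  have V0fd : FiniteDimensional K V0 := by
    have hle : V0 ≤ Box h (fun _ : Unit => m) {()} p.natDegree := by
      rintro _ ⟨q, rfl⟩
      rw [hL, ← modByMonic_add_div q p, map_add, LinearMap.add_apply, mul_comm, map_mul,
        Module.End.mul_apply, hpm, map_zero, add_zero]
      refine Box_mem h (fun _ : Unit => m) _ _ _ () (by simp) ?_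
      rw [← degree_eq_natDegree hp.ne_zero]
      exact degree_modByMonic_lt q hmon
    have := Box_fd h (fun _ : Unit => m) {()} p.natDegree
    exact Submodule.finiteDimensional_of_le hle
  have V0D : (∀ y, D y = 0 → y = 0) ∨ (p = X - C 1 ∧ ∀ y ∈ V0, D y = 0) := by
    rcases alt with h1 | ⟨h1, h2⟩
    · exact Or.inl h1
    · refine Or.inr ⟨h1, ?_⟩
      rintro _ ⟨q, rfl⟩
      rw [hL, twist S.Dh, h2, map_zero]
  let op : ℤ → Module.End K M := fun i => if 0 ≤ i then J ^ i.toNat else D ^ (-i).toNat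
  have opn : ∀ n : ℕ, op n = J ^ n := by intro n; simp [op]
  have opneg : ∀ n : ℕ, op (-n) = D ^ n := by
    intro n
    rcases Nat.eq_zero_or_pos n with rfl | hn
    · simp [op]
    · have : ¬ (0 : ℤ) ≤ -n := by omega
      simp only [op, if_neg this]; simp
  have caseZ : ∀ i : ℤ, (∃ n : ℕ, i = n) ∨ ∃ n : ℕ, i = -((n + 1 : ℕ) : ℤ) := by
    intro i
    rcases le_or_gt 0 i with h0 | h0
    · exact Or.inl ⟨i.toNat, by omega⟩
    · exact Or.inr ⟨(-i).toNat - 1, by omega⟩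
  have Jpow : ∀ n : ℕ, ∀ y, (J ^ n) (h y) = h ((J ^ n) y) + (-(n : K)) • (J ^ n) y := by
    intro n
    induction n with
    | zero => intro y; simp
    | succ n ih =>
      intro y
      rw [pow_succ', Module.End.mul_apply, Module.End.mul_apply, ih, map_add, S.Jh, map_smul, add_assoc,
        ← add_smul]
      congr 2; push_cast; ring
  have optw : ∀ i y, op i (h y) = h (op i y) + (-(i : K)) • op i y := by
    intro i y
    rcases caseZ i with ⟨n, rfl⟩ | ⟨n, rfl⟩
    · rw [opn, Jpow]; simp
    · rw [opneg, twistD S]; simp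
  let W : ℤ → Submodule K M := fun i => V0.map (op i)
  have Wkil : ∀ i, ∀ y ∈ W i, aeval h (shp p i) y = 0 := by
    rintro i _ ⟨v, hv, rfl⟩
    unfold shp
    rw [← twist (optw i), V0p v hv, map_zero]
  have JJ : ∀ y, J y = 0 → y = 0 := by
    intro y hy; rw [← S.DJ y, hy, map_zero]
  refine ⟨W, Module.finrank K V0, hp, hmon, Wkil, ?_, ?_, ?_, ?_, ?_, ?_, ?_⟩
  · rintro i _ ⟨v, hv, rfl⟩
    refine ⟨h v + (i : K) • v, Submodule.add_mem _ (V0h v hv) (Submodule.smul_mem _ _ hv), ?_⟩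
    rw [map_add, optw, map_smul, add_assoc, ← add_smul]; simp
  · rintro i _ ⟨v, hv, rfl⟩
    refine ⟨v, hv, ?_⟩
    rcases caseZ i with ⟨n, rfl⟩ | ⟨n, rfl⟩
    · cases n with
      | zero => 
        have := opneg 1
        have h2 := opn 0
        simp at this h2 ⊢
        rw [this, h2]; simp
      | succ n =>
        rw [show ((n + 1 : ℕ) : ℤ) - 1 = (n : ℤ) by push_cast; ring, opn, opn, pow_succ',
          Module.End.mul_apply, S.DJ]
    · rw [show -((n + 1 : ℕ) : ℤ) - 1 = -((n + 2 : ℕ) : ℤ) by push_cast; ring, opneg, opneg, pow_succ' D (n+1)]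
      rfl
  · rintro i _ ⟨v, hv, rfl⟩
    rcases caseZ i with ⟨n, rfl⟩ | ⟨n, rfl⟩
    · refine ⟨v, hv, ?_⟩
      rw [show ((n : ℤ) + 1) = ((n + 1 : ℕ) : ℤ) by push_cast; ring, opn, opn, pow_succ']
      rfl
    · rcases V0D with h1 | ⟨h1, h2⟩
      · refine ⟨v, hv, ?_⟩
        rw [show -((n + 1 : ℕ) : ℤ) + 1 = -(n : ℤ) by push_cast; ring, opneg, opneg, pow_succ',
          Module.End.mul_apply]
        symm
        rw [← sub_eq_zero]
        apply h1
        rw [map_sub, S.DJ, sub_self]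
      · rw [opneg, pow_succ, Module.End.mul_apply, h2 v hv, map_zero, map_zero]
        exact Submodule.zero_mem _
  · intro i; infer_instance
  · intro i; exact Submodule.finrank_map_le _ _
  · refine ⟨m, ⟨m, ?_, ?_⟩, hm⟩
    · have := memV 1; simpa using this
    · have := opn 0; simp at this; rw [this]; rfl
  · intro i hi y hy hDy
    rcases V0D with h1 | ⟨h1, h2⟩
    · exact h1 y hDy
    · have e1 := S.hE y
      rw [hDy, map_zero, sub_zero] at e1
      have e2 := Wkil i y hy
      refine bez (shp_coprime hp hmon hi) e2 (h := h) ?_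
      rw [shp_zero, h1]; simp [e1]

lemma exists_grad {h D J : Module.End K M} (S : Sys h D J) (q : K[X]) (hq : q ≠ 0) (m : M) (hm : m ≠ 0)
    (hqm : aeval h q m = 0) : ∃ p W d, Grad h D J p W d := by
  by_cases hinj : ∀ y, D y = 0 → y = 0
  · obtain ⟨p, hp, m', hm', hpm⟩ := exists_irr h q hq m hm hqm
    refine ⟨p * C p.leadingCoeff⁻¹, grad_of S _ (irreducible_mul_leadingCoeff_inv.mpr hp)
      (monic_mul_leadingCoeff_inv hp.ne_zero) m' hm' ?_ (Or.inl hinj)⟩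
    rw [mul_comm, map_mul, Module.End.mul_apply, hpm, map_zero]
  · push Not at hinj
    obtain ⟨v, hv, hv0⟩ := hinj
    refine ⟨X - C 1, grad_of S _ (irreducible_X_sub_C 1) (monic_X_sub_C 1) v hv0 ?_ (Or.inr ⟨rfl, hv⟩)⟩
    have e1 := S.hE v
    rw [hv, map_zero, sub_zero] at e1
    simp [e1]
end Abs5

section Abs6
variable {K : Type*} [Field K] [CharZero K] {M : Type*} [AddCommGroup M] [Module K M]

lemma finsup_fd {W : ℤ → Submodule K M} {d : ℕ} (fd : ∀ i, FiniteDimensional K (W i))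
    (bd : ∀ i, Module.finrank K (W i) ≤ d) (s : Finset ℤ) :
    FiniteDimensional K (⨆ i ∈ s, W i : Submodule K M) ∧
      Module.finrank K (⨆ i ∈ s, W i : Submodule K M) ≤ s.card * d := by
  classical
  induction s using Finset.induction_on with
  | empty =>
    have : (⨆ i ∈ (∅ : Finset ℤ), W i : Submodule K M) = ⊥ := by simp
    rw [this]
    exact ⟨inferInstance, by simp⟩
  | insert a s ha ih =>
    obtain ⟨i1, i2⟩ := ih
    have := fd a
    rw [Finset.iSup_insert, Finset.card_insert_of_notMem ha]
    refine ⟨inferInstance, (Submodule.finrank_add_le_finrank_add_finrank _ _).trans ?_⟩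
    have := bd a
    rw [add_mul]; omega

lemma filt_grad {h D J : Module.End K M} (hs : Simp3 h D J) {p : K[X]} {W : ℤ → Submodule K M}
    {d : ℕ} (G : Grad h D J p W d) :
    Filt h D J (fun n => ⨆ i ∈ Finset.Icc (-(n : ℤ)) n, W i) (2 * d) d := by
  let Mn : ℕ → Submodule K M := fun n => ⨆ i ∈ Finset.Icc (-(n : ℤ)) n, W i
  have le1 : ∀ (n : ℕ) (i : ℤ), -(n : ℤ) ≤ i → i ≤ n → W i ≤ Mn n := by
    intro n i h1 h2
    exact le_iSup₂ (f := fun (i : ℤ) (_ : i ∈ Finset.Icc (-(n : ℤ)) n) => W i) i (Finset.mem_Icc.mpr ⟨h1, h2⟩)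
  have mono : Monotone Mn := by
    intro n n' hn
    refine iSup₂_le fun i hi => ?_
    rw [Finset.mem_Icc] at hi
    exact le1 n' i (by omega) (by omega)
  have step : ∀ (T : Module.End K M) (t : ℤ), -1 ≤ t → t ≤ 1 → (∀ i, ∀ y ∈ W i, T y ∈ W (i + t)) →
      ∀ n, ∀ y ∈ Mn n, T y ∈ Mn (n + 1) := by
    intro T t h1 h2 hT n
    suffices Mn n ≤ (Mn (n + 1)).comap T from fun y hy => this hy
    refine iSup₂_le fun i hi y hy => ?_
    rw [Finset.mem_Icc] at hi
    exact le1 (n + 1) (i + t) (by push_cast; omega) (by push_cast; omega) (hT i y hy)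
  have hh := step h 0 (by omega) (by omega) (fun i y hy => by rw [add_zero]; exact G.Wh i y hy)
  have hD := step D (-1) (by omega) (by omega) G.WD
  have hJ := step J 1 (by omega) (by omega) G.WJ
  refine ⟨mono, fun n => (finsup_fd G.fd G.bd _).1, fun n => ?_, hh, hD, hJ, ?_⟩
  · refine (finsup_fd G.fd G.bd _).2.trans (le_of_eq ?_)
    have : (Finset.Icc (-(n : ℤ)) n).card = 2 * n + 1 := by rw [Int.card_Icc]; omega
    rw [this]; ring
  · have hdir : Directed (· ≤ ·) Mn := mono.directed_le
    have htop : (⨆ n, Mn n) = ⊤ := by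
      apply hs
      · rw [Submodule.ne_bot_iff]
        obtain ⟨y, hy, hy0⟩ := G.ne
        exact ⟨y, (le_iSup Mn 0) (le1 0 0 (by simp) (by simp) hy), hy0⟩
      · intro y hy
        obtain ⟨n, hn⟩ := (Submodule.mem_iSup_of_directed _ hdir).mp hy
        exact (le_iSup Mn (n+1)) (hh n y hn)
      · intro y hy
        obtain ⟨n, hn⟩ := (Submodule.mem_iSup_of_directed _ hdir).mp hy
        exact (le_iSup Mn (n+1)) (hD n y hn)
      · intro y hy
        obtain ⟨n, hn⟩ := (Submodule.mem_iSup_of_directed _ hdir).mp hy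
        exact (le_iSup Mn (n+1)) (hJ n y hn)
    intro y
    have hy : y ∈ ⨆ n, Mn n := by rw [htop]; trivial
    exact (Submodule.mem_iSup_of_directed _ hdir).mp hy

lemma Grad.powD {h D J : Module.End K M} {p : K[X]} {W : ℤ → Submodule K M}
    {d : ℕ} (G : Grad h D J p W d) (k : ℕ) : ∀ i, ∀ y ∈ W i, (D ^ k) y ∈ W (i - k) := by
  induction k with
  | zero => intro i y hy; simpa using hy
  | succ k ih =>
    intro i y hy
    rw [pow_succ', Module.End.mul_apply]
    have := G.WD _ _ (ih i y hy)
    rwa [show i - ((k + 1 : ℕ) : ℤ) = i - k - 1 by push_cast; ring]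

lemma Grad.powD_inj {h D J : Module.End K M} {p : K[X]} {W : ℤ → Submodule K M}
    {d : ℕ} (G : Grad h D J p W d) (k : ℕ) (i : ℤ) (hi : ∀ k' < k, i - (k' : ℕ) ≠ 0) (y : M) (hy : y ∈ W i)
    (h0 : (D ^ k) y = 0) : y = 0 := by
  induction k with
  | zero => simpa using h0
  | succ k ih =>
    apply ih (fun k' hk' => hi k' (by omega))
    rw [pow_succ', Module.End.mul_apply] at h0
    exact G.inj _ (hi k (by omega)) _ (G.powD k i y hy) h0

lemma Grad.aev {h D J : Module.End K M} {p : K[X]} {W : ℤ → Submodule K M}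
    {d : ℕ} (G : Grad h D J p W d) (q : K[X]) (i : ℤ) (y : M) (hy : y ∈ W i) : aeval h q y ∈ W i := by
  induction q using Polynomial.induction_on' with
  | add a b ha hb => rw [map_add]; exact Submodule.add_mem _ ha hb
  | monomial n c =>
    rw [aeval_monomial, Module.End.mul_apply, Module.algebraMap_end_apply]
    refine Submodule.smul_mem _ _ ?_
    induction n with
    | zero => simpa using hy
    | succ n ih => rw [pow_succ', Module.End.mul_apply]; exact G.Wh _ _ ih

lemma Grad.extract {h D J : Module.End K M} {p : K[X]} {W : ℤ → Submodule K M}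
    {d : ℕ} (G : Grad h D J p W d) (p' : ℕ → K[X]) (e : ℕ) (s : Finset ℤ) (c : ℤ → M) (hc : ∀ i, c i ∈ W i)
    (h0 : ∑ k ∈ Finset.range (e + 1), aeval h (p' k) ((D ^ k) (∑ i ∈ s, c i)) = 0)
    (i0 : ℤ) (k0 : ℕ) (hi0 : i0 ∈ s) (hk0 : k0 ≤ e)
    (uniq : ∀ i ∈ s, ∀ k ≤ e, p' k ≠ 0 → i - (k : ℕ) = i0 - k0 → i = i0 ∧ k = k0)
    (cop : IsCoprime (shp p (i0 - k0)) (p' k0)) : (D ^ k0) (c i0) = 0 := by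
  classical
  let t : ℤ := i0 - k0
  let f : ℕ × ℤ → M := fun x => aeval h (p' x.1) ((D ^ x.1) (c x.2))
  have hf : ∀ x, f x ∈ W (x.2 - x.1) := fun x => G.aev _ _ _ (G.powD _ _ _ (hc _))
  let B := Finset.range (e + 1) ×ˢ s
  have h1 : ∑ x ∈ B, f x = 0 := by
    rw [Finset.sum_product, ← h0]
    refine Finset.sum_congr rfl fun k _ => ?_
    rw [map_sum, map_sum]
  let T : Finset ℤ := (B.image fun x => x.2 - (x.1 : ℤ)).erase t
  let Q : K[X] := ∏ j ∈ T, shp p j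
  have hQ : ∀ j ∈ T, ∀ y ∈ W j, aeval h Q y = 0 := by
    intro j hj y hy
    have : Q = (∏ i ∈ T.erase j, shp p i) * shp p j := (Finset.prod_erase_mul T _ hj).symm
    rw [this, map_mul, Module.End.mul_apply, G.kil j y hy, map_zero]
  have h2 : aeval h Q (f (k0, i0)) = 0 := by
    have h3 := congrArg (aeval h Q) h1
    rw [map_zero, map_sum, Finset.sum_eq_single (k0, i0)] at h3
    · exact h3
    · rintro ⟨k, i⟩ hx hne
      have hx' := Finset.mem_product.mp hx
      by_cases hk : p' k = 0
      · simp [f, hk]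
      refine hQ (i - k) (Finset.mem_erase.mpr ⟨?_, Finset.mem_image.mpr ⟨(k, i), hx, rfl⟩⟩) _ (hf (k, i))
      intro heq
      have hkk := Finset.mem_range.mp hx'.1
      obtain ⟨rfl, rfl⟩ := uniq i hx'.2 k (by omega) hk heq
      exact hne rfl
    · intro hx
      exact absurd (Finset.mem_product.mpr ⟨Finset.mem_range.mpr (by omega), hi0⟩) hx
  have hmem := G.powD k0 i0 (c i0) (hc i0)
  have h4 : f (k0, i0) = 0 := by
    refine bez (h := h) (a := shp p t) (b := Q) ?_ (G.kil t _ (hf (k0, i0))) h2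
    apply IsCoprime.prod_right
    intro j hj
    exact shp_coprime G.irr G.mon (Finset.ne_of_mem_erase hj).symm
  exact bez cop (G.kil _ _ hmem) h4

lemma ker_fd_grad {h D J : Module.End K M} (hs : Simp3 h D J) {p : K[X]} {W : ℤ → Submodule K M}
    {d : ℕ} (G : Grad h D J p W d)
    (p' : ℕ →₀ K[X]) (hp : p' ≠ 0) (P : Submodule K M) (hP : ∀ y ∈ P, ev h D y p' = 0) :
    FiniteDimensional K P := by
  classical
  have F := filt_grad hs G
  have hne : p'.support.Nonempty := Finsupp.support_nonempty_iff.mpr hp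
  obtain ⟨s, hs0, hmin⟩ : ∃ a, p' a ≠ 0 ∧ ∀ k ∈ p'.support, a ≤ k :=
    ⟨p'.support.min' hne, Finsupp.mem_support_iff.mp (Finset.min'_mem _ hne),
      fun k hk => Finset.min'_le _ _ hk⟩
  obtain ⟨e, he0, hmax⟩ : ∃ e, p' e ≠ 0 ∧ ∀ k ∈ p'.support, k ≤ e := 
    ⟨p'.support.max' hne, Finsupp.mem_support_iff.mp (Finset.max'_mem _ hne),
      fun k hk => Finset.le_max' _ _ hk⟩
  have hse : s ≤ e := hmin e (Finsupp.mem_support_iff.mpr he0)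
  obtain ⟨n1, hn1⟩ := shp_fin G.irr G.mon (p' s) hs0
  obtain ⟨n2, hn2⟩ := shp_fin G.irr G.mon (p' e) he0
  let n0 := n1 + n2 + e + 1
  suffices hle : P ≤ ⨆ i ∈ Finset.Icc (-(n0 : ℤ)) n0, W i by
    have := (finsup_fd G.fd G.bd (Finset.Icc (-(n0 : ℤ)) n0)).1
    exact Submodule.finiteDimensional_of_le hle
  intro y hy
  obtain ⟨n, hn⟩ := F.ex y
  obtain ⟨c, hc, hyc⟩ := mem_finsum.mp hn
  let s' := (Finset.Icc (-(n : ℤ)) n).filter fun i => c i ≠ 0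
  have hys : y = ∑ i ∈ s', c i := by rw [hyc, Finset.sum_filter_ne_zero]
  have hev := hP y hy
  rw [ev_range h D y p' e hmax, hys] at hev
  rcases s'.eq_empty_or_nonempty with hemp | hnon
  · rw [hys, hemp]; simp
  have lo : -(n0 : ℤ) ≤ s'.min' hnon := by
    by_contra hlt
    have hl := Finset.min'_mem s' hnon
    have hll : ∀ i ∈ s', s'.min' hnon ≤ i := fun i hi => Finset.min'_le _ _ hi
    generalize s'.min' hnon = l at *
    refine (Finset.mem_filter.mp hl).2 ?_
    refine G.powD_inj e l (fun k' hk' => by omega) _ (hc l) ?_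
    refine G.extract p' e s' c hc hev l e hl le_rfl ?_ ?_
    · intro i hi k hk _ heq
      have := hll i hi
      omega
    · apply hn2
      rw [Int.abs_eq_natAbs]; omega
  have hi : s'.max' hnon ≤ n0 := by
    by_contra hlt
    have hl := Finset.max'_mem s' hnon
    have hll : ∀ i ∈ s', i ≤ s'.max' hnon := fun i hi => Finset.le_max' _ _ hi
    generalize s'.max' hnon = l at *
    refine (Finset.mem_filter.mp hl).2 ?_
    refine G.powD_inj s l (fun k' hk' => by omega) _ (hc l) ?_
    refine G.extract p' e s' c hc hev l s hl hse ?_ ?_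
    · intro i hi k hk hk0 heq
      have := hll i hi
      have := hmin k (Finsupp.mem_support_iff.mpr hk0)
      omega
    · apply hn1
      rw [Int.abs_eq_natAbs]; omega
  rw [hys]
  refine Submodule.sum_mem _ fun i hi' => ?_
  refine (le_iSup₂ (f := fun (i : ℤ) (_ : i ∈ Finset.Icc (-(n0 : ℤ)) n0) => W i) i
    (Finset.mem_Icc.mpr ⟨lo.trans (Finset.min'_le _ _ hi'), (Finset.le_max' _ _ hi').trans hi⟩)) (hc i)

/-- Both cases together. -/
lemma main_abs {h D J : Module.End K M} (S : Sys h D J) (hs : Simp3 h D J) (hne : ∃ m : M, m ≠ 0) :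
    (∃ Mn A B, Filt h D J Mn A B) ∧
    ∀ (p : ℕ →₀ K[X]), p ≠ 0 → ∀ P : Submodule K M, (∀ y ∈ P, ev h D y p = 0) →
      FiniteDimensional K P := by
  by_cases TF : ∀ q : K[X], q ≠ 0 → ∀ y, aeval h q y = 0 → y = 0
  · obtain ⟨m, hm⟩ := hne
    have Dinj : ∀ y, D y = 0 → y = 0 := by
      intro y hy
      apply TF (X - C 1) (X_sub_C_ne_zero 1)
      have e1 := S.hE y
      rw [hy, map_zero, sub_zero] at e1
      simp [e1]
    have JD : ∀ y, J (D y) = y := by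
      intro y
      rw [← sub_eq_zero]
      apply Dinj
      rw [map_sub, S.DJ, sub_self]
    obtain ⟨p, hp, hpm⟩ := exists_rel S hs TF m hm
    obtain ⟨Mn, A, B, F⟩ := filt_TF S hs JD m hm p hp hpm
    exact ⟨⟨Mn, A, B, F⟩, fun p' hp' P hP => ker_fd_TF S JD F TF p' hp' P hP⟩
  · push Not at TF
    obtain ⟨q, hq, m, hqm, hm⟩ := TF
    obtain ⟨p, W, d, G⟩ := exists_grad S q hq m hm hqm
    exact ⟨⟨_, _, _, filt_grad hs G⟩, fun p' hp' P hP => ker_fd_grad hs G p' hp' P hP⟩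
end Abs6

lemma der_mono (n : ℕ) (c : K) : derOp K (monomial n c) = monomial (n - 1) (c * n) :=
  derivative_monomial c n
lemma x_mono (n : ℕ) (c : K) : xOp K (monomial n c) = monomial (n + 1) c := by
  simp [xOp, X_mul_monomial]
lemma int_mono (n : ℕ) (c : K) : intOp K (monomial n c) = monomial (n + 1) (((n : K) + 1)⁻¹ * c) := by
  simp [intOp, Polynomial.lsum_apply, sum_monomial_index, smul_monomial]
lemma H_mono (n : ℕ) (c : K) : Hop K (monomial n c) = monomial n (c * (n + 1)) := by
  simp [Hop, x_mono, der_mono]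

lemma op_ext {A B : Module.End K K[X]} (h : ∀ n (c : K), A (monomial n c) = B (monomial n c)) : A = B := by
  apply Polynomial.lhom_ext'
  intro n
  ext
  simp [h]

lemma id_DJ : derOp K * intOp K = 1 := by
  apply op_ext; intro n c
  have : (n : K) + 1 ≠ 0 := by exact_mod_cast Nat.succ_ne_zero n
  rw [Module.End.mul_apply, int_mono, der_mono]
  simp; congr 1; field_simp

lemma id_DH : derOp K * Hop K = Hop K * derOp K + derOp K := by
  apply op_ext; intro n c
  rw [LinearMap.add_apply, Module.End.mul_apply, Module.End.mul_apply, H_mono, der_mono, der_mono, H_mono]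
  rw [← map_add]
  cases n with
  | zero => simp
  | succ n => rw [Nat.add_sub_cancel]; congr 1; push_cast; ring

lemma id_JH : intOp K * Hop K = Hop K * intOp K - intOp K := by
  apply op_ext; intro n c
  have : (n : K) + 1 ≠ 0 := by exact_mod_cast Nat.succ_ne_zero n
  rw [LinearMap.sub_apply, Module.End.mul_apply, Module.End.mul_apply, H_mono, int_mono, int_mono, H_mono,
    ← map_sub]
  congr 1; push_cast; field_simp; ring

lemma id_HE : Hop K * (1 - intOp K * derOp K) = 1 - intOp K * derOp K := by
  apply op_ext; intro n c
  rw [Module.End.mul_apply, LinearMap.sub_apply, Module.End.mul_apply, Module.End.one_apply, der_mono,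
    int_mono]
  cases n with
  | zero =>
    have := H_mono K 0 c
    simp at this
    simp [this]
  | succ n =>
    have : (n : K) + 1 ≠ 0 := by exact_mod_cast Nat.succ_ne_zero n
    have e : ((n : K) + 1)⁻¹ * (c * (n + 1)) = c := by field_simp
    simp [e]

lemma id_X : xOp K = intOp K * Hop K := by
  apply op_ext; intro n c
  have : (n : K) + 1 ≠ 0 := by exact_mod_cast Nat.succ_ne_zero n
  rw [Module.End.mul_apply, H_mono, int_mono, x_mono]
  congr 1; field_simp

lemma I1_ind {P : I1 K → Prop} (hH : P (HelI K)) (hD : P (DelI K)) (hJ : P (IntI K))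
    (halg : ∀ c : K, P (algebraMap K (I1 K) c)) (hadd : ∀ a b, P a → P b → P (a + b))
    (hmul : ∀ a b, P a → P b → P (a * b)) : ∀ a, P a := by
  rintro ⟨a, ha⟩
  have ha' : a ∈ Algebra.adjoin K {xOp K, derOp K, intOp K} := ha
  suffices ∃ b : I1 K, (b : Module.End K K[X]) = a ∧ P b by
    obtain ⟨b, hb, hP⟩ := this
    have : b = ⟨a, ha⟩ := Subtype.ext hb
    rwa [← this]
  clear ha
  induction ha' using Algebra.adjoin_induction with
  | mem x hx =>
    rcases hx with rfl | rfl | rfl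
    · exact ⟨IntI K * HelI K, (id_X K).symm, hmul _ _ hJ hH⟩
    · exact ⟨DelI K, rfl, hD⟩
    · exact ⟨IntI K, rfl, hJ⟩
  | algebraMap r => exact ⟨algebraMap K (I1 K) r, rfl, halg r⟩
  | add x y _ _ hx hy =>
    obtain ⟨b, rfl, hb⟩ := hx
    obtain ⟨c, rfl, hc⟩ := hy
    exact ⟨b + c, rfl, hadd _ _ hb hc⟩
  | mul x y _ _ hx hy =>
    obtain ⟨b, rfl, hb⟩ := hx
    obtain ⟨c, rfl, hc⟩ := hy
    exact ⟨b * c, rfl, hmul _ _ hb hc⟩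

/- structure of F -/
lemma e_eq (i j : ℕ) : eOp K i j = intOp K ^ i * (1 - intOp K * derOp K) * derOp K ^ j := by
  unfold eOp
  rw [pow_succ, pow_succ' (derOp K), mul_sub, sub_mul, mul_one]; simp only [mul_assoc]

lemma DnH (j : ℕ) : derOp K ^ j * Hop K = Hop K * derOp K ^ j + (j : K) • derOp K ^ j := by
  induction j with
  | zero => simp
  | succ j ih =>
    rw [pow_succ, mul_assoc, id_DH, mul_add, ← mul_assoc, ih, add_mul, ← pow_succ, mul_assoc, ← pow_succ,
      smul_mul_assoc, ← pow_succ, add_assoc]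
    congr 1
    push_cast
    rw [add_smul, one_smul]

lemma EH : (1 - intOp K * derOp K) * Hop K = 1 - intOp K * derOp K := by
  have h1 := id_HE K
  have h2 : (1 - intOp K * derOp K) * Hop K = Hop K * (1 - intOp K * derOp K) := by
    rw [sub_mul, mul_assoc, id_DH, mul_add, ← mul_assoc, id_JH, mul_sub, sub_mul, one_mul, mul_one,
      mul_assoc]
    abel
  rw [h2, h1]

lemma F_mul_right (a : I1 K) : ∀ f ∈ Fspan K, f * (a : Module.End K K[X]) ∈ Fspan K := by
  have gen : ∀ b : I1 K, (∀ i j, eOp K i j * (b : Module.End K K[X]) ∈ Fspan K) →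
      ∀ f ∈ Fspan K, f * (b : Module.End K K[X]) ∈ Fspan K := by
    intro b hb f hf
    induction hf using Submodule.span_induction with
    | mem x hx => obtain ⟨⟨i, j⟩, rfl⟩ := hx; exact hb i j
    | zero => rw [zero_mul]; exact Submodule.zero_mem _
    | add x y _ _ hx hy => rw [add_mul]; exact Submodule.add_mem _ hx hy
    | smul c x _ hx => rw [smul_mul_assoc]; exact Submodule.smul_mem _ _ hx
  have mem : ∀ i j, eOp K i j ∈ Fspan K := fun i j => Submodule.subset_span ⟨(i, j), rfl⟩
  induction a using I1_ind with
  | hH =>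
    apply gen; intro i j
    have : eOp K i j * Hop K = ((1 : K) + j) • eOp K i j := by
      rw [e_eq, mul_assoc, DnH, mul_add, ← mul_assoc, mul_assoc (intOp K ^ i), EH, add_smul, one_smul,
        mul_smul_comm]
    change eOp K i j * Hop K ∈ _
    rw [this]; exact Submodule.smul_mem _ _ (mem _ _)
  | hD =>
    apply gen; intro i j
    have : eOp K i j * derOp K = eOp K i (j + 1) := by
      rw [e_eq, e_eq, mul_assoc, ← pow_succ]
    change eOp K i j * derOp K ∈ _
    rw [this]; exact mem _ _
  | hJ =>
    apply gen; intro i j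
    change eOp K i j * intOp K ∈ _
    cases j with
    | zero =>
      have : eOp K i 0 * intOp K = 0 := by
        rw [e_eq, pow_zero, mul_one, mul_assoc, sub_mul, mul_assoc, id_DJ]; simp
      rw [this]; exact Submodule.zero_mem _
    | succ j =>
      have : eOp K i (j + 1) * intOp K = eOp K i j := by
        rw [e_eq, e_eq, pow_succ, mul_assoc, mul_assoc (derOp K ^ j), id_DJ, mul_one]
      rw [this]; exact mem _ _
  | halg c =>
    intro f hf
    have : ((algebraMap K (I1 K) c : I1 K) : Module.End K K[X]) = algebraMap K _ c := rfl
    rw [this, ← Algebra.commutes, ← Algebra.smul_def]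
    exact Submodule.smul_mem _ _ hf
  | hadd a b ha hb =>
    intro f hf
    change f * ((a : Module.End K K[X]) + b) ∈ _
    rw [mul_add]; exact Submodule.add_mem _ (ha f hf) (hb f hf)
  | hmul a b ha hb =>
    intro f hf
    change f * ((a : Module.End K K[X]) * b) ∈ _
    rw [← mul_assoc]; exact hb _ (ha f hf)

lemma mem_F_of (a : I1 K) (n : ℕ) (h : DelI K ^ n * a = 0) : (a : Module.End K K[X]) ∈ Fspan K := by
  have h0 : derOp K ^ n * (a : Module.End K K[X]) = 0 := congrArg Subtype.val h
  have h1 : ∑ i ∈ Finset.range n, eOp K i i = 1 - intOp K ^ n * derOp K ^ n := by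
    unfold eOp
    rw [Finset.sum_range_sub' (fun i => intOp K ^ i * derOp K ^ i)]; simp
  have h2 : (∑ i ∈ Finset.range n, eOp K i i) * (a : Module.End K K[X]) = a := by
    rw [h1, sub_mul, mul_assoc, h0]; simp
  rw [← h2]
  exact F_mul_right K a _ (Submodule.sum_mem _ fun i _ => Submodule.subset_span ⟨(i, i), rfl⟩)

lemma Dpow_ne (n : ℕ) : DelI K ^ n * DelI K ≠ 0 := by
  intro h
  have h0 : derOp K ^ n * derOp K = 0 := congrArg Subtype.val h
  rw [← pow_succ] at h0
  have h1 : ∀ n : ℕ, derOp K ^ n * intOp K ^ n = 1 := by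
    intro n
    induction n with
    | zero => simp
    | succ n ih => 
      rw [pow_succ, pow_succ' (intOp K), mul_assoc, ← mul_assoc (derOp K), id_DJ, one_mul, ih]
  have h2 := h1 (n + 1)
  rw [h0, zero_mul] at h2
  exact zero_ne_one h2

section Act
variable (M : Type*) [AddCommGroup M] [Module K M] [Module (I1 K) M] [IsScalarTower K (I1 K) M]

lemma act_apply (a : I1 K) (y : M) : actMap K M a y = a • y := rfl

lemma algMap_smul' (c : K) (y : M) : (algebraMap K (I1 K) c) • y = c • y := algebraMap_smul _ c y

lemma I1_sub_smul (a b : I1 K) (y : M) : (a - b) • y = a • y - b • y := by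
  rw [eq_sub_iff_add_eq, ← add_smul]
  congr 1
  exact Subtype.ext (sub_add_cancel _ _)

lemma simple_alt [hs : IsSimpleModule (I1 K) M] (Q : Submodule (I1 K) M) : Q = ⊥ ∨ Q = ⊤ := by
  have h1 := hs.1
  exact h1.eq_bot_or_eq_top Q

lemma act_pow (a : I1 K) (n : ℕ) (y : M) : (actMap K M a ^ n) y = a ^ n • y := by
  induction n with
  | zero => simp
  | succ n ih => rw [pow_succ', pow_succ', Module.End.mul_apply, ih, mul_smul, act_apply]

lemma act_sys : Sys (actMap K M (HelI K)) (actMap K M (DelI K)) (actMap K M (IntI K)) where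
  DJ y := by
    have h1 : DelI K * IntI K = 1 := Subtype.ext (id_DJ K)
    rw [act_apply, act_apply, ← mul_smul, h1, one_smul]
  Dh y := by
    have h1 : DelI K * HelI K = HelI K * DelI K + DelI K := Subtype.ext (id_DH K)
    rw [act_apply, act_apply, act_apply, act_apply, ← mul_smul, h1, add_smul, mul_smul, one_smul]
  Jh y := by
    have h1 : IntI K * HelI K = HelI K * IntI K - IntI K := Subtype.ext (id_JH K)
    rw [act_apply, act_apply, act_apply, act_apply, ← mul_smul, h1, I1_sub_smul, mul_smul, neg_smul, one_smul,
      sub_eq_add_neg]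
  hE y := by
    have h1 : HelI K * (1 - IntI K * DelI K) = 1 - IntI K * DelI K := Subtype.ext (id_HE K)
    have h2 : y - IntI K • DelI K • y = (1 - IntI K * DelI K) • y := by
      rw [I1_sub_smul, one_smul, mul_smul]
    rw [act_apply, act_apply, act_apply, h2, ← mul_smul, h1]

lemma act_simp3 [IsSimpleModule (I1 K) M] :
    Simp3 (actMap K M (HelI K)) (actMap K M (DelI K)) (actMap K M (IntI K)) := by
  intro P hne hH hD hJ
  have st : ∀ a : I1 K, ∀ y ∈ P, a • y ∈ P := by
    intro a
    induction a using I1_ind with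
    | hH => exact hH
    | hD => exact hD
    | hJ => exact hJ
    | halg c => intro y hy; rw [algMap_smul']; exact P.smul_mem c hy
    | hadd a b ha hb => intro y hy; rw [add_smul]; exact P.add_mem (ha y hy) (hb y hy)
    | hmul a b ha hb => intro y hy; rw [mul_smul]; exact ha _ (hb y hy)
  let Q : Submodule (I1 K) M :=
    { carrier := P
      add_mem' := P.add_mem
      zero_mem' := P.zero_mem
      smul_mem' := fun a y hy => st a y hy }
  have memQ : ∀ y, y ∈ Q ↔ y ∈ P := fun y => Iff.rfl
  rcases simple_alt K M Q with h | h
  · exfalso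
    apply hne
    rw [eq_bot_iff]
    intro y hy
    have : y ∈ Q := hy
    rw [h] at this
    simpa using this
  · rw [eq_top_iff]
    intro y _
    rw [← memQ, h]; trivial

lemma ev_map {A B : Type*} [AddCommGroup A] [Module K A] [AddCommGroup B] [Module K B]
    (φ : A →ₗ[K] B) {h D : Module.End K A} {h' D' : Module.End K B} (hh : ∀ y, φ (h y) = h' (φ y))
    (hD : ∀ y, φ (D y) = D' (φ y)) (m : A) (p : ℕ →₀ K[X]) : φ (ev h D m p) = ev h' D' (φ m) p := by
  have pw : ∀ (g : Module.End K A) (g' : Module.End K B), (∀ y, φ (g y) = g' (φ y)) → ∀ (n : ℕ) y,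
      φ ((g ^ n) y) = (g' ^ n) (φ y) := by
    intro g g' hg n
    induction n with
    | zero => intro y; simp
    | succ n ih => intro y; rw [pow_succ', pow_succ', Module.End.mul_apply, Module.End.mul_apply, hg, ih]
  have ae : ∀ (q : K[X]) y, φ (aeval h q y) = aeval h' q (φ y) := by
    intro q y
    induction q using Polynomial.induction_on' with
    | add a b ha hb => simp [ha, hb]
    | monomial n c => simp [aeval_monomial, pw h h' hh]
  rw [ev_apply, ev_apply, Finsupp.sum, Finsupp.sum, map_sum]
  refine Finset.sum_congr rfl fun k _ => ?_
  rw [ae, pw D D' hD]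

lemma exists_repr (a : I1 K) :
    DRep (actMap K (I1 K) (HelI K)) (actMap K (I1 K) (DelI K)) 1 a := by
  have S := act_sys K (I1 K)
  have : ∀ y, DRep (actMap K (I1 K) (HelI K)) (actMap K (I1 K) (DelI K)) 1 y →
      DRep (actMap K (I1 K) (HelI K)) (actMap K (I1 K) (DelI K)) 1 (a • y) := by
    induction a using I1_ind with
    | hH => exact fun y hy => hy.h S
    | hD => exact fun y hy => hy.D S
    | hJ => exact fun y hy => hy.J S
    | halg c => 
      intro y hy
      rw [algMap_smul' K (I1 K) c y]
      exact hy.smul c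
    | hadd a b ha hb => intro y hy; rw [add_smul]; exact (ha y hy).add S (hb y hy)
    | hmul a b ha hb => intro y hy; rw [mul_smul]; exact ha _ (hb y hy)
  have h1 := this 1 DRep.self
  rwa [smul_eq_mul, mul_one] at h1

lemma repr_act (a : I1 K) (ha : ∀ n : ℕ, DelI K ^ n * a ≠ 0) : ∃ (n : ℕ) (p : ℕ →₀ K[X]), p ≠ 0 ∧
    ∀ y : M, (DelI K ^ n * a) • y = ev (actMap K M (HelI K)) (actMap K M (DelI K)) y p := by
  obtain ⟨n, p, hp⟩ := exists_repr K a
  rw [act_pow, smul_eq_mul] at hp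
  refine ⟨n, p, ?_, ?_⟩
  · rintro rfl
    rw [map_zero] at hp
    exact ha n hp
  · intro y
    let φ : I1 K →ₗ[K] M := 
      { toFun := fun b => b • y
        map_add' := fun b c => add_smul b c y
        map_smul' := fun c b => smul_assoc c b y }
    have h1 := ev_map K φ (h := actMap K (I1 K) (HelI K)) (D := actMap K (I1 K) (DelI K))
      (h' := actMap K M (HelI K)) (D' := actMap K M (DelI K))
      (fun b => mul_smul (HelI K) b y) (fun b => mul_smul (DelI K) b y) 1 p
    have h2 : φ 1 = y := one_smul _ y
    rw [h2, ← hp] at h1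
    exact h1

lemma filt_act {Mn : ℕ → Submodule K M} {A B : ℕ}
    (F : Filt (actMap K M (HelI K)) (actMap K M (DelI K)) (actMap K M (IntI K)) Mn A B) (a : I1 K) :
    ∃ k, ∀ n, ∀ y ∈ Mn n, a • y ∈ Mn (n + k) := by
  induction a using I1_ind with
  | hH => exact ⟨1, F.hh⟩
  | hD => exact ⟨1, F.hD⟩
  | hJ => exact ⟨1, F.hJ⟩
  | halg c => exact ⟨0, fun n y hy => by rw [algMap_smul']; exact Submodule.smul_mem _ _ hy⟩
  | hadd a b ha hb =>
    obtain ⟨k, hk⟩ := ha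
    obtain ⟨l, hl⟩ := hb
    refine ⟨k + l, fun n y hy => ?_⟩
    rw [add_smul]
    exact Submodule.add_mem _ (F.mono (by omega) (hk n y hy)) (F.mono (by omega) (hl n y hy))
  | hmul a b ha hb =>
    obtain ⟨k, hk⟩ := ha
    obtain ⟨l, hl⟩ := hb
    refine ⟨l + k, fun n y hy => ?_⟩
    rw [mul_smul, ← add_assoc]
    exact hk _ _ (hl n y hy)

lemma fred_simple [IsSimpleModule (I1 K) M] (a : I1 K) (ha : ∀ n : ℕ, DelI K ^ n * a ≠ 0) :
    FiniteDimensional K (LinearMap.ker (actMap K M a)) ∧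
    FiniteDimensional K (M ⧸ LinearMap.range (actMap K M a)) := by
  have : Nontrivial M := IsSimpleModule.nontrivial (I1 K) M
  obtain ⟨⟨Mn, A, B, F⟩, hker⟩ := main_abs (act_sys K M) (act_simp3 K M) (exists_ne (0 : M))
  obtain ⟨n, p, hp, hpy⟩ := repr_act K M a ha
  have k1 : FiniteDimensional K (LinearMap.ker (actMap K M a)) := by
    apply hker p hp
    intro y hy
    have hy' : a • y = 0 := hy
    rw [← hpy, mul_smul, hy', smul_zero]
  refine ⟨k1, ?_⟩
  obtain ⟨k, hk⟩ := filt_act K M F a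
  exact coker_fd_of_growth (actMap K M a) Mn F.mono F.fd F.ex A B F.bd k hk k1
end Act

universe w

lemma ind_gen {R : Type*} [Ring R] (P : ∀ (M : Type w) [AddCommGroup M] [Module R M], Prop)
    (h0 : ∀ (M : Type w) [AddCommGroup M] [Module R M] [Subsingleton M], P M)
    (h1 : ∀ (M N Q : Type w) [AddCommGroup M] [Module R M] [AddCommGroup N] [Module R N]
      [AddCommGroup Q] [Module R Q] (i : N →ₗ[R] M) (q : M →ₗ[R] Q),
      Function.Injective i → Function.Surjective q → (∀ y, q y = 0 → ∃ x, i x = y) →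
      IsSimpleModule R Q → P N → P M)
    (M : Type w) [AddCommGroup M] [Module R M] (hM : IsFiniteLength R M) : P M := by
  induction hM with
  | of_subsingleton => exact h0 _
  | @of_simple_quotient M _ _ N _ _ ih =>
    exact h1 M N (M ⧸ N) N.subtype N.mkQ (Submodule.subtype_injective N)
      (Submodule.mkQ_surjective N)
      (fun y hy => ⟨⟨y, (Submodule.Quotient.mk_eq_zero N).mp hy⟩, rfl⟩) inferInstance ih

section Gen
variable {R : Type*} [Ring R] {k : Type*} [Field k] [Algebra k R]

/-- action of `a`, generic version -/
def gact (M : Type*) [AddCommGroup M] [Module k M] [Module R M] [IsScalarTower k R M] (a : R) :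
    M →ₗ[k] M where
  toFun m := a • m
  map_add' := smul_add a
  map_smul' c m := by
    simp only [RingHom.id_apply]
    rw [← algebraMap_smul R c m, ← mul_smul, ← Algebra.commutes, mul_smul,
      algebraMap_smul]

lemma gtower_comp (N : Type*) [AddCommGroup N] [Module R N] :
    letI : Module k N := Module.compHom N (algebraMap k R)
    IsScalarTower k R N := by
  let _ : Module k N := Module.compHom N (algebraMap k R)
  refine ⟨fun c b y => ?_⟩
  change (c • b) • y = algebraMap k R c • b • y
  rw [Algebra.smul_def, mul_smul]

lemma gfred_fl (a : R) (hsimp : ∀ (Q : Type w) [AddCommGroup Q] [Module R Q] [Module k Q]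
      [IsScalarTower k R Q] [IsSimpleModule R Q],
      FiniteDimensional k (LinearMap.ker (gact (k := k) Q a)) ∧
      FiniteDimensional k (Q ⧸ LinearMap.range (gact (k := k) Q a)))
    (M : Type w) [AddCommGroup M] [Module R M] (hM : IsFiniteLength R M) :
    ∀ [Module k M] [IsScalarTower k R M],
    FiniteDimensional k (LinearMap.ker (gact (k := k) M a)) ∧
    FiniteDimensional k (M ⧸ LinearMap.range (gact (k := k) M a)) := by
  refine ind_gen (R := R) (fun M i1 i2 => ∀ [Module k M] [IsScalarTower k R M],
    FiniteDimensional k (LinearMap.ker (gact (k := k) M a)) ∧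
    FiniteDimensional k (M ⧸ LinearMap.range (gact (k := k) M a))) ?_ ?_ M hM
  · intro M _ _ _ _ _; exact ⟨inferInstance, inferInstance⟩
  · intro M N Q _ _ _ _ _ _ i q hi hq hiq hs ih _ _
    let _ : Module k N := Module.compHom N (algebraMap k R)
    let _ : Module k Q := Module.compHom Q (algebraMap k R)
    have : IsScalarTower k R N := gtower_comp N
    have : IsScalarTower k R Q := gtower_comp Q
    obtain ⟨k1, c1⟩ := ih
    obtain ⟨k2, c2⟩ := hsimp Q
    let i' : N →ₗ[k] M :=
      { toFun := i
        map_add' := map_add i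
        map_smul' := fun c x => by
          rw [← algebraMap_smul R c x, ← algebraMap_smul R (_ : k) (i x)]
          exact map_smul i _ x }
    let q' : M →ₗ[k] Q :=
      { toFun := q
        map_add' := map_add q
        map_smul' := fun c x => by
          rw [← algebraMap_smul R c x, ← algebraMap_smul R (_ : k) (q x)]
          exact map_smul q _ x }
    exact fred_ext i' q' hq hiq hi (gact N a) (gact M a) (gact Q a)
      (fun x => (map_smul i a x).symm) (fun y => map_smul q a y) k1 c1 k2 c2
end Gen

lemma fred_fl (a : I1 K) (ha : ∀ n : ℕ, DelI K ^ n * a ≠ 0) (M : Type w) [AddCommGroup M]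
    [Module (I1 K) M] (hM : IsFiniteLength (I1 K) M) [Module K M] [IsScalarTower K (I1 K) M] :
    FiniteDimensional K (LinearMap.ker (actMap K M a)) ∧
    FiniteDimensional K (M ⧸ LinearMap.range (actMap K M a)) := by
  have hs : ∀ (Q : Type w) [AddCommGroup Q] [Module (I1 K) Q] [Module K Q]
      [IsScalarTower K (I1 K) Q] [IsSimpleModule (I1 K) Q],
      FiniteDimensional K (LinearMap.ker (actMap K Q a)) ∧
      FiniteDimensional K (Q ⧸ LinearMap.range (actMap K Q a)) := fun Q => fred_simple K Q a ha
  have e : ∀ (Q : Type w) [i1 : AddCommGroup Q] [i2 : Module (I1 K) Q] [i3 : Module K Q]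
      [i4 : IsScalarTower K (I1 K) Q],
      @gact (I1 K) _ K _ _ Q i1 i3 i2 i4 a = actMap K Q a := fun Q _ _ _ _ => LinearMap.ext fun _ => rfl
  rw [← e]
  refine @gfred_fl (I1 K) _ K _ _ a ?_ M _ _ hM _ _
  intro Q i1 i2 i3 i4 i5
  have h1 := @hs Q i1 i2 i3 i4 i5
  rw [← e] at h1
  exact h1

lemma F_rank (M : Type*) [AddCommGroup M] [Module K M] [Module (I1 K) M] [IsScalarTower K (I1 K) M]
    (hM : IsFiniteLength (I1 K) M) (f : I1 K) (hf : (f : Module.End K K[X]) ∈ Fspan K) :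
    FiniteDimensional K (LinearMap.range (actMap K M f)) := by
  have key : ∀ g ∈ Fspan K, ∃ b : I1 K, (b : Module.End K K[X]) = g ∧
      FiniteDimensional K (LinearMap.range (actMap K M b)) := by
    intro g hg
    induction hg using Submodule.span_induction with
    | mem x hx =>
      obtain ⟨⟨i, j⟩, rfl⟩ := hx
      refine ⟨IntI K ^ i * (1 - IntI K * DelI K) * DelI K ^ j, (e_eq K i j).symm, ?_⟩
      have kd := (fred_fl K (DelI K) (Dpow_ne K) M hM).1
      have hle : LinearMap.range (actMap K M (IntI K ^ i * (1 - IntI K * DelI K) * DelI K ^ j)) ≤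
          (LinearMap.ker (actMap K M (DelI K))).map (actMap K M (IntI K ^ i)) := by
        rintro _ ⟨y, rfl⟩
        refine ⟨(1 - IntI K * DelI K) • DelI K ^ j • y, ?_, ?_⟩
        · change DelI K • (1 - IntI K * DelI K) • DelI K ^ j • y = 0
          have h2 : DelI K * (1 - IntI K * DelI K) = 0 := by
            apply Subtype.ext
            change derOp K * (1 - intOp K * derOp K) = 0
            rw [mul_sub, ← mul_assoc, id_DJ, mul_one, one_mul, sub_self]
          rw [← mul_smul, h2, zero_smul]
        · rw [act_apply, act_apply, mul_smul, mul_smul]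
      exact Submodule.finiteDimensional_of_le hle
    | zero =>
      refine ⟨0, rfl, ?_⟩
      have : actMap K M 0 = 0 := LinearMap.ext fun y => zero_smul _ y
      rw [this, LinearMap.range_zero]; infer_instance
    | add x y _ _ hx hy =>
      obtain ⟨b, rfl, hb⟩ := hx
      obtain ⟨c, rfl, hc⟩ := hy
      refine ⟨b + c, rfl, ?_⟩
      have hle : LinearMap.range (actMap K M (b + c)) ≤
          LinearMap.range (actMap K M b) ⊔ LinearMap.range (actMap K M c) := by
        rintro _ ⟨y, rfl⟩
        rw [act_apply, add_smul]
        exact Submodule.add_mem_sup ⟨y, rfl⟩ ⟨y, rfl⟩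
      exact Submodule.finiteDimensional_of_le hle
    | smul c x _ hx =>
      obtain ⟨b, rfl, hb⟩ := hx
      refine ⟨c • b, rfl, ?_⟩
      have hle : LinearMap.range (actMap K M (c • b)) ≤ LinearMap.range (actMap K M b) := by
        rintro _ ⟨y, rfl⟩
        rw [act_apply, smul_assoc]
        exact Submodule.smul_mem _ _ ⟨y, rfl⟩
      exact Submodule.finiteDimensional_of_le hle
  obtain ⟨b, hb, hfd⟩ := key _ hf
  have : b = f := Subtype.ext hb
  rwa [← this]

/-- For `a ∈ I₁ \ F`, `f ∈ F` and a nonzero left `I₁`-module `M` of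
finite length, the kernels and cokernels of `a_M` and `(a+f)_M` are all
finite-dimensional over `K` and the index of `a_M` is unchanged by adding `f`. -/
theorem index_invariant_under_adding_F
    (M : Type*) [AddCommGroup M] [Module K M] [Module (I1 K) M]
    [IsScalarTower K (I1 K) M] [Nontrivial M]
    (hM : IsFiniteLength (I1 K) M) (a f : I1 K)
    (ha : (a : Module.End K (Polynomial K)) ∉ Fspan K)
    (hf : (f : Module.End K (Polynomial K)) ∈ Fspan K) :
    FiniteDimensional K (LinearMap.ker (actMap K M a)) ∧
    FiniteDimensional K (M ⧸ LinearMap.range (actMap K M a)) ∧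
    FiniteDimensional K (LinearMap.ker (actMap K M (a + f))) ∧
    FiniteDimensional K (M ⧸ LinearMap.range (actMap K M (a + f))) ∧
    (Module.finrank K (LinearMap.ker (actMap K M (a + f))) : ℤ) -
        (Module.finrank K (M ⧸ LinearMap.range (actMap K M (a + f))) : ℤ) =
      (Module.finrank K (LinearMap.ker (actMap K M a)) : ℤ) -
        (Module.finrank K (M ⧸ LinearMap.range (actMap K M a)) : ℤ) := by
  have ha1 : ∀ n : ℕ, DelI K ^ n * a ≠ 0 := fun n h => ha (mem_F_of K a n h)
  have ha2 : ∀ n : ℕ, DelI K ^ n * (a + f) ≠ 0 := by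
    intro n h
    apply ha
    have h1 := mem_F_of K (a + f) n h
    have h2 := Submodule.sub_mem _ h1 hf
    have h3 : ((a + f : I1 K) : Module.End K (Polynomial K)) - f = a := add_sub_cancel_right _ _
    rwa [h3] at h2
  obtain ⟨k1, c1⟩ := fred_fl K a ha1 M hM
  obtain ⟨k2, c2⟩ := fred_fl K (a + f) ha2 M hM
  refine ⟨k1, c1, k2, c2, ?_⟩
  have hr := F_rank K M hM f hf
  have hW : FiniteDimensional K (M ⧸ LinearMap.ker (actMap K M f)) :=
    LinearEquiv.finiteDimensional (actMap K M f).quotKerEquivRange.symm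
  refine index_perturb (actMap K M (a + f)) (actMap K M a) (LinearMap.ker (actMap K M f)) ?_
  intro y hy
  have hy' : f • y = 0 := hy
  rw [act_apply, act_apply, add_smul, hy', add_zero]

end
end

section
/- Every unit u of the algebra I_1 can be written uniquely as u = λ·v where λ ∈ K is nonzero and v is a unit of I_1 with v − 1 ∈ F; moreover the center of the group of units of I_1 is exactly { λ·1 : λ ∈ K, λ ≠ 0 }. -/
set_option linter.unusedSectionVars false

open Polynomial

noncomputable section

variable (K : Type*) [Field K] [CharZero K]

set_option synthInstance.maxHeartbeats 400000
set_option maxHeartbeats 1000000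

namespace I1aux

/-- divided-power coefficient -/
def cf (m : ℕ) : Polynomial K →ₗ[K] K := (m.factorial : K) • Polynomial.lcoeff K m

/-- divided power -/
def yy (n : ℕ) : Polynomial K := Polynomial.monomial n ((n.factorial : K)⁻¹)

lemma fac_ne (n : ℕ) : (n.factorial : K) ≠ 0 := by exact_mod_cast n.factorial_ne_zero

lemma cf_apply (m : ℕ) (f : Polynomial K) : cf K m f = m.factorial * f.coeff m := by
  simp [cf]

lemma cf_yy (m n : ℕ) : cf K m (yy K n) = if m = n then 1 else 0 := by
  rw [cf_apply, yy, Polynomial.coeff_monomial]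
  by_cases h : n = m
  · subst h; simp [fac_ne K n]
  · simp [h, Ne.symm h]

lemma cf_ext {f g : Polynomial K} (h : ∀ m, cf K m f = cf K m g) : f = g := by
  ext m
  have := h m
  rw [cf_apply, cf_apply] at this
  exact mul_left_cancel₀ (fac_ne K m) this

lemma expand (f : Polynomial K) : f = ∑ j ∈ f.support, cf K j f • yy K j := by
  conv_lhs => rw [f.as_sum_support]
  refine Finset.sum_congr rfl fun j _ => ?_
  rw [cf_apply, yy, Polynomial.smul_monomial, smul_eq_mul]
  congr 1
  field_simp [fac_ne K j]

lemma cf_end (u : Module.End K (Polynomial K)) (f : Polynomial K) (m : ℕ) :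
    cf K m (u f) = ∑ j ∈ f.support, cf K j f * cf K m (u (yy K j)) := by
  conv_lhs => rw [expand K f]
  simp only [map_sum, map_smul, smul_eq_mul]

lemma cf_eq_zero (f : Polynomial K) (j : ℕ) (h : j ∉ f.support) : cf K j f = 0 := by
  rw [cf_apply, Polynomial.notMem_support_iff.1 h, mul_zero]

lemma end_ext {u v : Module.End K (Polynomial K)} (h : ∀ n, u (yy K n) = v (yy K n)) : u = v := by
  refine LinearMap.ext fun f => ?_
  apply cf_ext
  intro m
  rw [cf_end, cf_end]
  simp only [h]

lemma cf_der (m : ℕ) (f : Polynomial K) : cf K m (derOp K f) = cf K (m + 1) f := by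
  rw [cf_apply, cf_apply]
  simp only [derOp]
  rw [Polynomial.coeff_derivative, Nat.factorial_succ]
  push_cast; ring

lemma cf_x (m : ℕ) (f : Polynomial K) : cf K (m + 1) (xOp K f) = (m + 1) * cf K m f := by
  rw [cf_apply, cf_apply]
  simp only [xOp, LinearMap.mulLeft_apply]
  rw [Polynomial.coeff_X_mul, Nat.factorial_succ]
  push_cast; ring

lemma cf_x0 (f : Polynomial K) : cf K 0 (xOp K f) = 0 := by
  rw [cf_apply]
  simp [xOp]

lemma int_yy (n : ℕ) : intOp K (yy K n) = yy K (n + 1) := by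
  simp only [intOp, yy, Polynomial.lsum_apply]
  rw [Polynomial.sum_monomial_index _ _ (by simp)]
  rw [LinearMap.smul_apply, Polynomial.smul_monomial, Nat.factorial_succ]
  congr 1
  push_cast
  rw [mul_inv, smul_eq_mul]

lemma cf_int (m : ℕ) (f : Polynomial K) : cf K (m + 1) (intOp K f) = cf K m f := by
  conv_rhs => rw [expand K f]
  rw [cf_end]
  simp [int_yy, cf_yy]

lemma cf_int0 (f : Polynomial K) : cf K 0 (intOp K f) = 0 := by
  rw [cf_end]
  simp [int_yy, cf_yy]

lemma cf_der_pow (j m : ℕ) (f : Polynomial K) : cf K m ((derOp K ^ j) f) = cf K (m + j) f := by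
  induction j generalizing m f with
  | zero => simp
  | succ j ih =>
    rw [pow_succ, Module.End.mul_apply, ih, cf_der]; rfl

lemma cf_int_pow (i m : ℕ) (f : Polynomial K) :
    cf K m ((intOp K ^ i) f) = if i ≤ m then cf K (m - i) f else 0 := by
  induction i generalizing m f with
  | zero => simp
  | succ i ih =>
    rw [pow_succ', Module.End.mul_apply]
    cases m with
    | zero => rw [cf_int0]; simp
    | succ m => rw [cf_int, ih]; simp

lemma eOp_apply (i j : ℕ) (f : Polynomial K) : eOp K i j f = cf K j f • yy K i := by
  apply cf_ext
  intro m
  simp only [eOp, LinearMap.sub_apply, Module.End.mul_apply, map_sub, cf_int_pow, cf_der_pow,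
    map_smul, cf_yy, smul_eq_mul]
  rcases lt_trichotomy m i with h | h | h
  · rw [if_neg (by omega), if_neg (by omega), if_neg (by omega)]; simp
  · subst h; simp
  · rw [if_pos (by omega), if_pos (by omega), if_neg (by omega)]
    rw [show m - (i + 1) + (j + 1) = m - i + j by omega]; simp

lemma mem_F_of (a : Module.End K (Polynomial K)) (N : ℕ) (h : ∀ n, N ≤ n → a (yy K n) = 0) :
    a ∈ Fspan K := by
  have : a = ∑ j ∈ Finset.range N, ∑ i ∈ (a (yy K j)).support,
      cf K i (a (yy K j)) • eOp K i j := by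
    apply end_ext
    intro n
    simp only [LinearMap.sum_apply, LinearMap.smul_apply, eOp_apply, cf_yy]
    by_cases hn : n < N
    · rw [Finset.sum_eq_single n]
      · simpa using expand K (a (yy K n))
      · intro b _ hb
        simp [hb]
      · intro h'; simp at h'; omega
    · rw [h n (by omega)]
      symm
      apply Finset.sum_eq_zero
      intro j hj
      have : j ≠ n := by simp at hj; omega
      simp [this]
  rw [this]
  refine Submodule.sum_mem _ fun j _ => Submodule.sum_mem _ fun i _ => Submodule.smul_mem _ _ ?_
  exact Submodule.subset_span ⟨(i, j), rfl⟩

lemma F_kills (a : Module.End K (Polynomial K)) (h : a ∈ Fspan K) :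
    ∃ N, ∀ n, N ≤ n → a (yy K n) = 0 := by
  induction h using Submodule.span_induction with
  | mem x hx =>
    obtain ⟨⟨i, j⟩, rfl⟩ := hx
    refine ⟨j + 1, fun n hn => ?_⟩
    simp only [eOp_apply, cf_yy]
    rw [if_neg (by omega), zero_smul]
  | zero => exact ⟨0, by simp⟩
  | add x y _ _ hx hy =>
    obtain ⟨N, hN⟩ := hx
    obtain ⟨M, hM⟩ := hy
    refine ⟨max N M, fun n hn => ?_⟩
    rw [LinearMap.add_apply, hN n (by omega), hM n (by omega), add_zero]
  | smul c x _ hx =>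
    obtain ⟨N, hN⟩ := hx
    exact ⟨N, fun n hn => by rw [LinearMap.smul_apply, hN n hn, smul_zero]⟩

/-- symbol predicate -/
def Sym (a : Module.End K (Polynomial K)) (p : ℤ → Polynomial K) (N : ℕ) : Prop :=
  (∀ k : ℤ, (N : ℤ) < |k| → p k = 0) ∧
    ∀ n m : ℕ, N ≤ n → cf K m (a (yy K n)) = (p ((m : ℤ) - n)).eval (n : K)

/-- has a symbol -/
def HasSym (a : Module.End K (Polynomial K)) : Prop := ∃ p N, Sym K a p N

variable {K}

lemma Sym.mono {a : Module.End K (Polynomial K)} {p N} (h : Sym K a p N) {M : ℕ} (hM : N ≤ M) :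
    Sym K a p M :=
  ⟨fun k hk => h.1 k (lt_of_le_of_lt (by exact_mod_cast hM) hk),
    fun n m hn => h.2 n m (hM.trans hn)⟩

lemma HasSym.add {a b : Module.End K (Polynomial K)} (ha : HasSym K a) (hb : HasSym K b) :
    HasSym K (a + b) := by
  obtain ⟨p, N, h⟩ := ha
  obtain ⟨q, M, h'⟩ := hb
  have h := h.mono (le_max_left N M)
  have h' := h'.mono (le_max_right N M)
  refine ⟨p + q, max N M, fun k hk => ?_, fun n m hn => ?_⟩
  · simp [h.1 k hk, h'.1 k hk]
  · simp [h.2 n m hn, h'.2 n m hn]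

lemma HasSym.smul {a : Module.End K (Polynomial K)} (c : K) (ha : HasSym K a) :
    HasSym K (c • a) := by
  obtain ⟨p, N, h⟩ := ha
  refine ⟨c • p, N, fun k hk => ?_, fun n m hn => ?_⟩
  · simp [h.1 k hk]
  · simp [h.2 n m hn]

lemma HasSym.one : HasSym K 1 := by
  refine ⟨fun k => if k = 0 then 1 else 0, 0, fun k hk => ?_, fun n m _ => ?_⟩
  · have : k ≠ 0 := by rintro rfl; simp at hk
    simp [this]
  · rw [Module.End.one_apply, cf_yy]
    by_cases h : m = n
    · simp [h]
    · have : (m : ℤ) - n ≠ 0 := by omega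
      simp [h, this]

lemma HasSym.der {a : Module.End K (Polynomial K)} (ha : HasSym K a) :
    HasSym K (derOp K * a) := by
  obtain ⟨p, N, h⟩ := ha
  refine ⟨fun k => p (k + 1), N + 1, fun k hk => ?_, fun n m hn => ?_⟩
  · apply h.1; push_cast at hk; rw [lt_abs] at *; omega
  · rw [Module.End.mul_apply, cf_der, h.2 n _ (by omega)]
    congr 2; push_cast; ring

lemma HasSym.int {a : Module.End K (Polynomial K)} (ha : HasSym K a) :
    HasSym K (intOp K * a) := by
  obtain ⟨p, N, h⟩ := ha
  refine ⟨fun k => p (k - 1), N + 1, fun k hk => ?_, fun n m hn => ?_⟩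
  · apply h.1; push_cast at hk; rw [lt_abs] at *; omega
  · rw [Module.End.mul_apply]
    cases m with
    | zero =>
      rw [cf_int0]
      simp only
      rw [h.1, Polynomial.eval_zero]
      rw [lt_abs]; push_cast; omega
    | succ m =>
      rw [cf_int, h.2 n _ (by omega)]
      congr 2; push_cast; ring

lemma HasSym.x {a : Module.End K (Polynomial K)} (ha : HasSym K a) :
    HasSym K (xOp K * a) := by
  obtain ⟨p, N, h⟩ := ha
  refine ⟨fun k => (X + C (k : K)) * p (k - 1), N + 1, fun k hk => ?_, fun n m hn => ?_⟩
  · simp only; rw [h.1, mul_zero]; push_cast at hk; rw [lt_abs] at *; omega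
  · rw [Module.End.mul_apply]
    cases m with
    | zero =>
      rw [cf_x0]
      simp only; rw [h.1, mul_zero, Polynomial.eval_zero]
      rw [lt_abs]; push_cast; omega
    | succ m =>
      rw [cf_x, h.2 n _ (by omega)]
      simp only [eval_mul, eval_add, eval_X, eval_C]
      congr 1
      · push_cast; ring
      · congr 2; push_cast; ring

lemma hasSym_of_mem {a : Module.End K (Polynomial K)} (ha : a ∈ I1 K) : HasSym K a := by
  suffices ∀ b, HasSym K b → HasSym K (a * b) by simpa using this 1 HasSym.one
  unfold I1 at ha
  induction ha using Algebra.adjoin_induction with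
  | mem x hx =>
    intro b hb
    rcases hx with rfl | rfl | rfl
    · exact hb.x
    · exact hb.der
    · exact hb.int
  | algebraMap r =>
    intro b hb
    rw [← Algebra.smul_def]
    exact hb.smul r
  | add x y _ _ hx hy =>
    intro b hb
    rw [add_mul]
    exact (hx b hb).add (hy b hb)
  | mul x y _ _ hx hy =>
    intro b hb
    rw [mul_assoc]
    exact hx _ (hy b hb)

lemma poly_eq_of_large {p q : Polynomial K} (N : ℕ)
    (h : ∀ n : ℕ, N ≤ n → p.eval (n : K) = q.eval (n : K)) : p = q := by
  apply Polynomial.eq_of_infinite_eval_eq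
  refine Set.Infinite.mono (s := (fun n : ℕ => (n : K)) '' Set.Ici N) ?_ ?_
  · rintro _ ⟨n, hn, rfl⟩
    exact h n hn
  · exact (Set.Ici_infinite N).image (Nat.cast_injective.injOn)

lemma extremal {u v : Module.End K (Polynomial K)} {p q : ℤ → Polynomial K} {N M : ℕ}
    (hu : Sym K u p N) (hv : Sym K v q M) (huv : u * v = 1) (k l : ℤ)
    (hk : p k ≠ 0) (hl : q l ≠ 0)
    (hext : ∀ i j, p i ≠ 0 → q j ≠ 0 → i + j = k + l → j = l) :
    k + l = 0 ∧ ∃ c : K, p k = C c := by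
  have hkN : |k| ≤ N := by by_contra h; exact hk (hu.1 k (by omega))
  have hlM : |l| ≤ M := by by_contra h; exact hl (hv.1 l (by omega))
  rw [abs_le] at hkN hlM
  have key : ∀ n : ℕ, N + M + M ≤ n →
      (q l * (p k).comp (X + C (l : K))).eval (n : K) = if k + l = 0 then 1 else 0 := by
    intro n hn
    obtain ⟨m, hm⟩ : ∃ m : ℕ, (m : ℤ) = n + k + l := ⟨(n + k + l).toNat, by omega⟩
    obtain ⟨j, hj⟩ : ∃ j : ℕ, (j : ℤ) = n + l := ⟨(n + l).toNat, by omega⟩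
    have h1 : cf K m (u (v (yy K n))) = if k + l = 0 then 1 else 0 := by
      rw [← Module.End.mul_apply, huv, Module.End.one_apply, cf_yy]
      by_cases h : k + l = 0
      · rw [if_pos h, if_pos (by omega)]
      · rw [if_neg h, if_neg (by omega)]
    rw [← h1, cf_end, Finset.sum_eq_single j]
    · rw [hv.2 n j (by omega), hu.2 j m (by omega)]
      rw [show (j : ℤ) - n = l by omega, show (m : ℤ) - j = k by omega]
      have : (j : K) = n + l := by exact_mod_cast congrArg (Int.cast : ℤ → K) hj
      simp [this]
    · intro i _ hi
      rw [hv.2 n i (by omega)]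
      by_cases hq : q ((i : ℤ) - n) = 0
      · simp [hq]
      have hiM : |(i : ℤ) - n| ≤ M := by by_contra h; exact hq (hv.1 _ (by omega))
      rw [abs_le] at hiM
      rw [hu.2 i m (by omega)]
      by_cases hp : p ((m : ℤ) - i) = 0
      · simp [hp]
      have := hext _ _ hp hq (by omega)
      omega
    · intro h
      rw [cf_eq_zero K _ _ h, zero_mul]
  have key2 : q l * (p k).comp (X + C (l : K)) = C (if k + l = 0 then 1 else 0) := by
    apply poly_eq_of_large (N + M + M)
    intro n hn
    rw [key n hn, eval_C]
  have hnd : ((p k).comp (X + C (l : K))).natDegree = (p k).natDegree := by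
    rw [natDegree_comp, natDegree_X_add_C, mul_one]
  have hcne : (p k).comp (X + C (l : K)) ≠ 0 := by
    intro h
    rw [Polynomial.comp_eq_zero_iff] at h
    rcases h with h | ⟨_, h⟩
    · exact hk h
    · have := congrArg Polynomial.natDegree h
      rw [natDegree_X_add_C, natDegree_C] at this
      omega
  constructor
  · by_contra h
    rw [if_neg h, C_0] at key2
    exact mul_ne_zero hl hcne key2
  · have := congrArg Polynomial.natDegree key2
    rw [natDegree_mul hl hcne, natDegree_C, hnd] at this
    exact ⟨_, eq_C_of_natDegree_eq_zero (by omega)⟩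

lemma exists_extr {u v : Module.End K (Polynomial K)} {p : ℤ → Polynomial K} {N : ℕ}
    (hu : Sym K u p N) (hvu : v * u = 1) :
    ∃ a b : ℤ, p a ≠ 0 ∧ p b ≠ 0 ∧ ∀ k, p k ≠ 0 → a ≤ k ∧ k ≤ b := by
  classical
  have hne : ∃ k, p k ≠ 0 := by
    by_contra! h
    have h0 : u (yy K N) = 0 := by
      apply cf_ext
      intro m
      rw [hu.2 N m le_rfl, h]; simp
    have h1 : yy K N = 0 := by
      rw [← Module.End.one_apply (R := K) (yy K N), ← hvu, Module.End.mul_apply, h0, map_zero]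
    have := cf_yy K N N
    rw [h1] at this
    simp at this
  set S : Finset ℤ := (Finset.Icc (-(N : ℤ)) N).filter fun k => p k ≠ 0 with hS
  have hmem : ∀ k, p k ≠ 0 → k ∈ S := by
    intro k hk
    have : |k| ≤ N := by by_contra h; exact hk (hu.1 k (by omega))
    rw [abs_le] at this
    simp [hS, hk, this.1, this.2]
  obtain ⟨k0, hk0⟩ := hne
  have hSne : S.Nonempty := ⟨k0, hmem _ hk0⟩
  refine ⟨S.min' hSne, S.max' hSne, (Finset.mem_filter.1 (S.min'_mem hSne)).2,
    (Finset.mem_filter.1 (S.max'_mem hSne)).2, fun k hk =>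
      ⟨S.min'_le _ (hmem k hk), S.le_max' _ (hmem k hk)⟩⟩

lemma shift_nonpos {u v : Module.End K (Polynomial K)} (huv : u * v = 1) {N : ℕ} {k : ℤ}
    (hu : ∀ n m : ℕ, N ≤ n → (m : ℤ) ≠ n + k → cf K m (u (yy K n)) = 0) : k ≤ 0 := by
  by_contra! hk
  let g : (Fin (N + 1) → K) →ₗ[K] Polynomial K :=
    ∑ i : Fin (N + 1), (LinearMap.proj i : (Fin (N + 1) → K) →ₗ[K] K).smulRight (yy K i)
  let φ : (Fin (N + 1) → K) →ₗ[K] (Fin N → K) :=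
    LinearMap.pi fun i => (cf K i) ∘ₗ v ∘ₗ g
  have hg : ∀ w (i : Fin (N + 1)), cf K i (g w) = w i := by
    intro w i
    simp only [g, LinearMap.sum_apply, LinearMap.smulRight_apply, map_sum, map_smul, cf_yy,
      LinearMap.proj_apply, smul_eq_mul]
    rw [Finset.sum_eq_single i]
    · simp
    · intro b _ hb
      rw [if_neg (fun h => hb (Fin.ext h.symm)), mul_zero]
    · simp
  have hinj : Function.Injective φ := by
    rw [← LinearMap.ker_eq_bot, LinearMap.ker_eq_bot']
    intro w hw
    ext i
    rw [← hg w i, ← Module.End.one_apply (R := K) (g w), ← huv, Module.End.mul_apply, cf_end]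
    apply Finset.sum_eq_zero
    intro j _
    by_cases hj : j < N
    · have := congrFun hw ⟨j, hj⟩
      have h2 : cf K j (v (g w)) = 0 := this
      rw [h2, zero_mul]
    · rw [hu j i (by omega) (by have := i.2; omega), mul_zero]
  have := LinearMap.finrank_le_finrank_of_injective hinj
  simp at this

lemma unit_form {u v : Module.End K (Polynomial K)} (hu : u ∈ I1 K) (hv : v ∈ I1 K)
    (huv : u * v = 1) (hvu : v * u = 1) :
    ∃ c : K, c ≠ 0 ∧ u - c • 1 ∈ Fspan K := by
  obtain ⟨p, N, hp⟩ := hasSym_of_mem hu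
  obtain ⟨q, M, hq⟩ := hasSym_of_mem hv
  obtain ⟨a, b, ha, hb, hab⟩ := exists_extr hp hvu
  obtain ⟨a', b', ha', hb', hab'⟩ := exists_extr hq huv
  have h1 := extremal hp hq huv a a' ha ha' (fun i j hi hj h => by
    have := hab i hi; have := hab' j hj; omega)
  have h2 := extremal hp hq huv b b' hb hb' (fun i j hi hj h => by
    have := hab i hi; have := hab' j hj; omega)
  have hle := hab a ha
  have hle' := hab' a' ha'
  have k1 : a ≤ 0 := by
    apply shift_nonpos huv (N := N)
    intro n m hn hm
    rw [hp.2 n m hn]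
    by_cases h : p ((m : ℤ) - n) = 0
    · simp [h]
    · have := hab _ h; omega
  have k2 : a' ≤ 0 := by
    apply shift_nonpos hvu (N := M)
    intro n m hn hm
    rw [hq.2 n m hn]
    by_cases h : q ((m : ℤ) - n) = 0
    · simp [h]
    · have := hab' _ h; omega
  obtain rfl : a = 0 := by omega
  obtain ⟨c, hc⟩ := h1.2
  refine ⟨c, ?_, ?_⟩
  · rintro rfl; simp [hc] at ha
  · apply mem_F_of K _ N
    intro n hn
    apply cf_ext
    intro m
    rw [LinearMap.sub_apply, LinearMap.smul_apply, Module.End.one_apply, map_sub, map_smul, cf_yy,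
      hp.2 n m hn, map_zero]
    by_cases hm : m = n
    · subst hm; simp [hc]
    · rw [if_neg hm]
      by_cases h : p ((m : ℤ) - n) = 0
      · simp [h]
      · have := hab _ h; omega

/-- `e_ij` in the algebra -/
def eI (i j : ℕ) : I1 K := ⟨eOp K i j, eOp_mem K i j⟩

lemma eI_sq {i j : ℕ} (h : i ≠ j) : (eI i j : I1 K) * eI i j = 0 := by
  apply Subtype.ext
  change eOp K i j * eOp K i j = 0
  apply LinearMap.ext
  intro f
  rw [Module.End.mul_apply, eOp_apply, eOp_apply, map_smul, cf_yy, if_neg h.symm]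
  simp

/-- elementary unit -/
def eU (i j : ℕ) (h : i ≠ j) : (I1 K)ˣ where
  val := 1 + eI i j
  inv := 1 - eI i j
  val_inv := by
    have : eOp K i j * eOp K i j = 0 := congrArg Subtype.val (eI_sq (K := K) h)
    apply Subtype.ext
    change (1 + eOp K i j) * (1 - eOp K i j) = 1
    rw [mul_sub, add_mul, add_mul, this]; simp
  inv_val := by
    have : eOp K i j * eOp K i j = 0 := congrArg Subtype.val (eI_sq (K := K) h)
    apply Subtype.ext
    change (1 - eOp K i j) * (1 + eOp K i j) = 1
    rw [mul_add, sub_mul, sub_mul, this]; simp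

lemma center_form (u : (I1 K)ˣ) (hu : u ∈ Subgroup.center (I1 K)ˣ) :
    ∃ c : K, (((u : I1 K)) : Module.End K (Polynomial K)) = c • 1 := by
  set w : Module.End K (Polynomial K) := ((u : I1 K) : Module.End K (Polynomial K)) with hw
  have key : ∀ i j, i ≠ j → w (yy K i) = cf K j (w (yy K j)) • yy K i := by
    intro i j h
    have h1 := Subgroup.mem_center_iff.1 hu (eU i j h)
    have h2 : (1 + eI i j : I1 K) * (u : I1 K) = (u : I1 K) * (1 + eI i j) :=
      congrArg Units.val h1
    rw [add_mul, mul_add, one_mul, mul_one, add_right_inj] at h2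
    have h3 : eOp K i j * w = w * eOp K i j := congrArg Subtype.val h2
    have h4 := LinearMap.congr_fun h3 (yy K j)
    rw [Module.End.mul_apply, Module.End.mul_apply, eOp_apply, eOp_apply, cf_yy] at h4
    simpa using h4.symm
  have hd : ∀ i j, i ≠ j → cf K i (w (yy K i)) = cf K j (w (yy K j)) := by
    intro i j h
    conv_lhs => rw [key i j h, map_smul, cf_yy]
    simp
  refine ⟨cf K 0 (w (yy K 0)), end_ext K fun n => ?_⟩
  rw [LinearMap.smul_apply, Module.End.one_apply]
  by_cases h : n = 0
  · subst h
    rw [hd 0 1 (by omega)]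
    exact key 0 1 (by omega)
  · exact key n 0 h

end I1aux

open I1aux in
/-- Every unit `u` of `I₁` can be written uniquely as `u = λ • v` with
`λ ∈ K` nonzero and `v` a unit of `I₁` with `v - 1 ∈ F`; moreover the centre of the group
of units of `I₁` is exactly `{λ • 1 : λ ∈ K, λ ≠ 0}`. -/
theorem units_of_I1_decomposition_and_center :
    (∀ u : (I1 K)ˣ, ∃! lv : K × (I1 K)ˣ, lv.1 ≠ 0 ∧
        ((lv.2 : I1 K) : Module.End K (Polynomial K)) - 1 ∈ Fspan K ∧
        (u : I1 K) = lv.1 • (lv.2 : I1 K)) ∧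
    (∀ u : (I1 K)ˣ, u ∈ Subgroup.center (I1 K)ˣ ↔
        ∃ lam : K, lam ≠ 0 ∧ (u : I1 K) = lam • (1 : I1 K)) := by
  constructor
  · intro u
    obtain ⟨c, hc, hF⟩ := unit_form (K := K) (u : I1 K).2 (u⁻¹ : (I1 K)ˣ).val.2
      (congrArg Subtype.val u.mul_inv) (congrArg Subtype.val u.inv_mul)
    let v : (I1 K)ˣ :=
      { val := c⁻¹ • (u : I1 K)
        inv := c • ((u⁻¹ : (I1 K)ˣ) : I1 K)
        val_inv := by rw [smul_mul_smul_comm, u.mul_inv, inv_mul_cancel₀ hc, one_smul]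
        inv_val := by rw [smul_mul_smul_comm, u.inv_mul, mul_inv_cancel₀ hc, one_smul] }
    refine ⟨(c, v), ⟨hc, ?_, ?_⟩, ?_⟩
    · have : ((v : I1 K) : Module.End K (Polynomial K)) - 1 =
          c⁻¹ • (((u : I1 K) : Module.End K (Polynomial K)) - c • 1) := by
        rw [smul_sub, smul_smul, inv_mul_cancel₀ hc, one_smul]; rfl
      change ((v : I1 K) : Module.End K (Polynomial K)) - 1 ∈ Fspan K
      rw [this]
      exact Submodule.smul_mem _ _ hF
    · change (u : I1 K) = c • (c⁻¹ • (u : I1 K))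
      rw [smul_smul, mul_inv_cancel₀ hc, one_smul]
    · rintro ⟨d, w⟩ ⟨hd, hw, huw⟩
      simp only at hd hw huw
      have huw' : ((u : I1 K) : Module.End K (Polynomial K)) =
          d • ((w : I1 K) : Module.End K (Polynomial K)) := congrArg Subtype.val huw
      obtain ⟨N, hN⟩ := F_kills K _ hF
      obtain ⟨M, hM⟩ := F_kills K _ hw
      have h1 := hN (max N M) (le_max_left _ _)
      have h2 := hM (max N M) (le_max_right _ _)
      rw [LinearMap.sub_apply, Module.End.one_apply, sub_eq_zero] at h2
      rw [huw', LinearMap.sub_apply, LinearMap.smul_apply, h2, LinearMap.smul_apply,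
        Module.End.one_apply, sub_eq_zero] at h1
      have h3 := congrArg (cf K (max N M)) h1
      rw [map_smul, map_smul, cf_yy] at h3
      have hdc : d = c := by simpa using h3
      subst hdc
      refine Prod.ext rfl (Units.ext ?_)
      change (w : I1 K) = d⁻¹ • (u : I1 K)
      rw [huw, smul_smul, inv_mul_cancel₀ hd, one_smul]
  · intro u
    constructor
    · intro hu
      obtain ⟨c, hc⟩ := center_form u hu
      refine ⟨c, ?_, Subtype.ext hc⟩
      rintro rfl
      have h0 : (u : I1 K) = 0 := Subtype.ext (by rw [hc, zero_smul]; rfl)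
      have h1 := u.mul_inv
      rw [h0, zero_mul] at h1
      have h2 : (0 : Module.End K (Polynomial K)) = 1 := congrArg Subtype.val h1
      exact zero_ne_one h2
    · rintro ⟨c, hc, hu⟩
      rw [Subgroup.mem_center_iff]
      intro g
      apply Units.ext
      rw [Units.val_mul, Units.val_mul, hu, mul_smul_comm, smul_mul_assoc, mul_one, one_mul]

end
end

section
/- The map sending a unit u of I_1 with u − 1 ∈ F to the inner automorphism ω_u : a ↦ u a u^{-1} is an injective group homomorphism from the group (1+F)^* := { units u of I_1 : u − 1 ∈ F } to the group of K-algebra automorphisms of I_1, and its image is exactly the set of all inner automorphisms of I_1 (i.e., conjugations by arbitrary units of I_1). -/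
set_option linter.unusedSectionVars false

open Polynomial

noncomputable section

variable (K : Type*) [Field K] [CharZero K]

set_option synthInstance.maxHeartbeats 400000
set_option maxHeartbeats 1000000

/-- The inner automorphism `ω_u : a ↦ u a u⁻¹` of `I₁` attached to a unit `u`. -/
def innerAut (u : (I1 K)ˣ) : I1 K ≃ₐ[K] I1 K where
  toFun a := ↑u * a * ↑u⁻¹
  invFun a := ↑u⁻¹ * a * ↑u
  left_inv a := by
    simp [mul_assoc, Units.inv_mul_cancel_left, Units.mul_inv_cancel_left,
      Units.inv_mul, Units.mul_inv]
  right_inv a := by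
    simp [mul_assoc, Units.inv_mul_cancel_left, Units.mul_inv_cancel_left,
      Units.inv_mul, Units.mul_inv]
  map_mul' a b := by
    simp [mul_assoc, Units.inv_mul_cancel_left, Units.mul_inv_cancel_left]
  map_add' a b := by
    show ↑u * (a + b) * ↑u⁻¹ = ↑u * a * ↑u⁻¹ + ↑u * b * ↑u⁻¹
    rw [mul_add, add_mul]
  commutes' r := by
    show ↑u * algebraMap K (I1 K) r * ↑u⁻¹ = algebraMap K (I1 K) r
    rw [← Algebra.commutes r ((u : I1 K)), mul_assoc, Units.mul_inv, mul_one]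

/-- The divided power basis element `xⁿ/n!`. -/
def xd (n : ℕ) : Polynomial K := Polynomial.monomial n ((n.factorial : K)⁻¹)

lemma fact_ne (n : ℕ) : (n.factorial : K) ≠ 0 := by exact_mod_cast n.factorial_ne_zero

lemma monomial_eq_xd (n : ℕ) (r : K) :
    Polynomial.monomial n r = (r * n.factorial) • xd K n := by
  have := fact_ne K n
  simp [xd, Polynomial.smul_monomial, mul_assoc, this]

lemma end_ext_xd {a b : Module.End K (Polynomial K)} (h : ∀ n, a (xd K n) = b (xd K n)) :
    a = b := by
  refine LinearMap.ext fun p => ?_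
  induction p using Polynomial.induction_on' with
  | add p q hp hq => simp [hp, hq]
  | monomial n r => rw [monomial_eq_xd, map_smul, map_smul, h]

lemma derOp_xd_succ (n : ℕ) : derOp K (xd K (n + 1)) = xd K n := by
  have h1 := fact_ne K n
  have h2 : (n : K) + 1 ≠ 0 := by exact_mod_cast n.succ_ne_zero
  simp only [derOp, xd, Polynomial.derivative_monomial, Nat.factorial_succ]
  congr 1
  push_cast
  field_simp

lemma derOp_xd_zero : derOp K (xd K 0) = 0 := by
  simp [derOp, xd]

lemma intOp_monomial (n : ℕ) (r : K) : intOp K (Polynomial.monomial n r) =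
    Polynomial.monomial (n + 1) (((n : K) + 1)⁻¹ * r) := by
  simp [intOp, Polynomial.lsum_apply, Polynomial.sum_monomial_index, Polynomial.smul_monomial]

lemma intOp_xd (n : ℕ) : intOp K (xd K n) = xd K (n + 1) := by
  have h1 := fact_ne K n
  have h2 : (n : K) + 1 ≠ 0 := by exact_mod_cast n.succ_ne_zero
  rw [xd, intOp_monomial, xd]
  congr 1
  simp only [Nat.factorial_succ]
  push_cast
  field_simp

lemma intOp_pow_xd (i n : ℕ) : (intOp K ^ i) (xd K n) = xd K (n + i) := by
  induction i with
  | zero => simp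
  | succ i ih => rw [pow_succ', Module.End.mul_apply, ih, intOp_xd]; rfl

lemma derOp_pow_xd (j n : ℕ) : (derOp K ^ j) (xd K (n + j)) = xd K n := by
  induction j generalizing n with
  | zero => simp
  | succ j ih =>
    rw [pow_succ, Module.End.mul_apply, ← add_assoc, derOp_xd_succ, ih]

lemma derOp_pow_xd_lt (j n : ℕ) (h : n < j) : (derOp K ^ j) (xd K n) = 0 := by
  obtain ⟨k, rfl⟩ := Nat.exists_eq_add_of_lt h
  have := derOp_pow_xd K n 0
  rw [zero_add] at this
  rw [show n + k + 1 = k + 1 + n by ring, pow_add, Module.End.mul_apply, this, pow_succ,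
    Module.End.mul_apply, derOp_xd_zero, map_zero]

lemma eOp_xd (i j n : ℕ) : eOp K i j (xd K n) = if n = j then xd K i else 0 := by
  simp only [eOp, LinearMap.sub_apply, Module.End.mul_apply]
  rcases lt_trichotomy n j with h | h | h
  · rw [derOp_pow_xd_lt K j n h, derOp_pow_xd_lt K (j+1) n (by omega), if_neg (by omega)]
    simp
  · subst h
    have := derOp_pow_xd K n 0
    rw [zero_add] at this
    rw [this, derOp_pow_xd_lt K (n+1) n (by omega), intOp_pow_xd]
    simp
  · obtain ⟨k, rfl⟩ := Nat.exists_eq_add_of_lt h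
    have h1 : j + k + 1 = (k + 1) + j := by ring
    have h2 : j + k + 1 = k + (j + 1) := by ring
    rw [if_neg (by omega)]
    nth_rewrite 1 [h1]
    rw [h2, derOp_pow_xd, derOp_pow_xd, intOp_pow_xd, intOp_pow_xd,
      show k + 1 + i = k + (i + 1) by ring, sub_self]

/-- Matrix entries in the divided power basis. -/
def ME (a : Module.End K (Polynomial K)) (m n : ℕ) : K :=
  (m.factorial : K) * (a (xd K n)).coeff m

lemma coeff_apply_eq (a : Module.End K (Polynomial K)) (p : Polynomial K) (m : ℕ) :
    (m.factorial : K) * (a p).coeff m =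
      ∑ k ∈ p.support, p.coeff k * k.factorial * ME K a m k := by
  conv_lhs => rw [p.as_sum_support]
  rw [map_sum, Polynomial.finsetSum_coeff, Finset.mul_sum]
  refine Finset.sum_congr rfl fun k _ => ?_
  rw [monomial_eq_xd, map_smul, Polynomial.coeff_smul, ME, smul_eq_mul]
  ring

lemma ME_mul (a b : Module.End K (Polynomial K)) (m n : ℕ) :
    ME K (a * b) m n = ∑ k ∈ (b (xd K n)).support, ME K b k n * ME K a m k := by
  rw [ME, Module.End.mul_apply, coeff_apply_eq]
  refine Finset.sum_congr rfl fun k _ => ?_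
  rw [ME, ME]; ring

lemma ME_mul_single (a b : Module.End K (Polynomial K)) (m n k : ℕ)
    (h : ∀ l, l ≠ k → ME K b l n * ME K a m l = 0) :
    ME K (a * b) m n = ME K b k n * ME K a m k := by
  rw [ME_mul]
  refine Finset.sum_eq_single k (fun l _ hl => h l hl) fun hk => ?_
  rw [Polynomial.notMem_support_iff] at hk
  simp [ME, hk]

lemma xd_coeff (n m : ℕ) : (xd K n).coeff m = if n = m then (n.factorial : K)⁻¹ else 0 := by
  simp [xd, Polynomial.coeff_monomial]

lemma ME_one (m n : ℕ) : ME K 1 m n = if m = n then 1 else 0 := by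
  rw [ME, Module.End.one_apply, xd_coeff]
  by_cases h : n = m
  · subst h; rw [if_pos rfl, if_pos rfl, mul_inv_cancel₀ (fact_ne K n)]
  · simp [h, Ne.symm h]

lemma ME_add (a b : Module.End K (Polynomial K)) (m n : ℕ) :
    ME K (a + b) m n = ME K a m n + ME K b m n := by simp [ME, mul_add]

lemma ME_smul (r : K) (a : Module.End K (Polynomial K)) (m n : ℕ) :
    ME K (r • a) m n = r * ME K a m n := by simp [ME]; ring

lemma ME_sub (a b : Module.End K (Polynomial K)) (m n : ℕ) :
    ME K (a - b) m n = ME K a m n - ME K b m n := by simp [ME, mul_sub]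

lemma apply_xd_eq (a : Module.End K (Polynomial K)) (n : ℕ) :
    a (xd K n) = ∑ k ∈ (a (xd K n)).support, ME K a k n • xd K k := by
  conv_lhs => rw [(a (xd K n)).as_sum_support]
  refine Finset.sum_congr rfl fun k _ => ?_
  rw [monomial_eq_xd, ME, mul_comm]

lemma mem_Fspan_of (a : Module.End K (Polynomial K)) (N : ℕ)
    (h : ∀ n, N ≤ n → a (xd K n) = 0) : a ∈ Fspan K := by
  have : a = ∑ j ∈ Finset.range N, ∑ i ∈ (a (xd K j)).support, ME K a i j • eOp K i j := by
    refine end_ext_xd K fun n => ?_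
    simp only [LinearMap.sum_apply, LinearMap.smul_apply, eOp_xd]
    by_cases hn : n < N
    · rw [Finset.sum_eq_single n]
      · simp [← apply_xd_eq]
      · intro j _ hj
        simp [Ne.symm hj]
      · simp [hn]
    · rw [h n (by omega), Finset.sum_eq_zero]
      intro j hj
      have : n ≠ j := by have := Finset.mem_range.1 hj; omega
      simp [this]
  rw [this]
  exact Submodule.sum_mem _ fun j _ => Submodule.sum_mem _ fun i _ =>
    Submodule.smul_mem _ _ (Submodule.subset_span ⟨(i, j), rfl⟩)

lemma of_mem_Fspan {a : Module.End K (Polynomial K)} (h : a ∈ Fspan K) :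
    ∃ N : ℕ, ∀ n, N ≤ n → a (xd K n) = 0 := by
  induction h using Submodule.span_induction with
  | mem x hx =>
    obtain ⟨⟨i, j⟩, rfl⟩ := hx
    refine ⟨j + 1, fun n hn => ?_⟩
    simp only [eOp_xd]
    rw [if_neg (by omega)]
  | zero => exact ⟨0, fun n _ => rfl⟩
  | add x y _ _ hx hy =>
    obtain ⟨N, hN⟩ := hx
    obtain ⟨M, hM⟩ := hy
    exact ⟨max N M, fun n hn => by
      rw [LinearMap.add_apply, hN n (by omega), hM n (by omega), add_zero]⟩
  | smul r x _ hx =>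
    obtain ⟨N, hN⟩ := hx
    exact ⟨N, fun n hn => by rw [LinearMap.smul_apply, hN n hn, smul_zero]⟩

/-- Asymptotic symbol: `a` acts on `x^[n]`, `n ≥ N`, by `∑_d c_d(n) x^[n+d]`. -/
def ASym (a : Module.End K (Polynomial K)) (c : ℤ → Polynomial K) (N : ℕ) : Prop :=
  (∀ d : ℤ, N < d.natAbs → c d = 0) ∧
    ∀ n : ℕ, N ≤ n → ∀ m : ℕ, ME K a m n = (c ((m : ℤ) - n)).eval (n : K)

lemma ASym.add {a b : Module.End K (Polynomial K)} {c c' : ℤ → Polynomial K} {N N' : ℕ}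
    (h : ASym K a c N) (h' : ASym K b c' N') :
    ASym K (a + b) (fun d => c d + c' d) (max N N') := by
  refine ⟨fun d hd => ?_, fun n hn m => ?_⟩ <;> beta_reduce
  · rw [h.1 d (by omega), h'.1 d (by omega), add_zero]
  · rw [ME_add, h.2 n (by omega), h'.2 n (by omega), Polynomial.eval_add]

lemma ASym.smul {a : Module.End K (Polynomial K)} {c : ℤ → Polynomial K} {N : ℕ} (r : K)
    (h : ASym K a c N) : ASym K (r • a) (fun d => r • c d) N := by
  refine ⟨fun d hd => ?_, fun n hn m => ?_⟩ <;> beta_reduce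
  · rw [h.1 d (by omega), smul_zero]
  · rw [ME_smul, h.2 n (by omega), Polynomial.eval_smul, smul_eq_mul]

lemma ASym_one : ASym K 1 (fun d => if d = 0 then 1 else 0) 0 := by
  refine ⟨fun d hd => ?_, fun n hn m => ?_⟩ <;> beta_reduce
  · rw [if_neg]; rintro rfl; simp at hd
  · rw [ME_one]
    by_cases h : m = n
    · simp [h]
    · have : (m : ℤ) - n ≠ 0 := by omega
      simp [h, this]

lemma ASym.x {a : Module.End K (Polynomial K)} {c : ℤ → Polynomial K} {N : ℕ}
    (h : ASym K a c N) :
    ASym K (xOp K * a) (fun d => (Polynomial.X + Polynomial.C (d : K)) * c (d - 1)) (N + 1) := by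
  refine ⟨fun d hd => ?_, fun n hn m => ?_⟩ <;> beta_reduce
  · rw [h.1 (d - 1) (by omega), mul_zero]
  · have key : ((n : K) + (((m : ℤ) - n : ℤ) : K)) = m := by push_cast; ring
    simp only [Polynomial.eval_mul, Polynomial.eval_add, Polynomial.eval_X, Polynomial.eval_C]
    rw [key, ME, Module.End.mul_apply, xOp, LinearMap.mulLeft_apply]
    cases m with
    | zero => simp
    | succ m =>
      have := h.2 n (by omega) m
      rw [ME] at this
      rw [show ((m + 1 : ℕ) : ℤ) - n - 1 = m - n by push_cast; ring, ← this,
        Polynomial.coeff_X_mul, Nat.factorial_succ]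
      push_cast; ring

lemma intOp_coeff (p : Polynomial K) (m : ℕ) :
    (intOp K p).coeff (m + 1) = ((m : K) + 1)⁻¹ * p.coeff m := by
  induction p using Polynomial.induction_on' with
  | add p q hp hq => simp [hp, hq, mul_add]
  | monomial n r =>
    rw [intOp_monomial, Polynomial.coeff_monomial, Polynomial.coeff_monomial]
    by_cases h : n = m
    · simp [h]
    · simp [h]

lemma intOp_coeff_zero (p : Polynomial K) : (intOp K p).coeff 0 = 0 := by
  induction p using Polynomial.induction_on' with
  | add p q hp hq => simp [hp, hq]
  | monomial n r => rw [intOp_monomial, Polynomial.coeff_monomial]; simp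

lemma ASym.int {a : Module.End K (Polynomial K)} {c : ℤ → Polynomial K} {N : ℕ}
    (h : ASym K a c N) :
    ASym K (intOp K * a) (fun d => c (d - 1)) (N + 1) := by
  refine ⟨fun d hd => h.1 (d - 1) (by omega), fun n hn m => ?_⟩
  beta_reduce
  rw [ME, Module.End.mul_apply]
  cases m with
  | zero =>
    rw [intOp_coeff_zero, h.1 _ (by omega)]; simp
  | succ m =>
    have := h.2 n (by omega) m
    have h2 : (m : K) + 1 ≠ 0 := by exact_mod_cast m.succ_ne_zero
    rw [ME] at this
    rw [show ((m + 1 : ℕ) : ℤ) - n - 1 = m - n by push_cast; ring, ← this,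
      intOp_coeff, Nat.factorial_succ]
    push_cast; field_simp

lemma ASym.der {a : Module.End K (Polynomial K)} {c : ℤ → Polynomial K} {N : ℕ}
    (h : ASym K a c N) :
    ASym K (derOp K * a) (fun d => c (d + 1)) (N + 1) := by
  refine ⟨fun d hd => h.1 (d + 1) (by omega), fun n hn m => ?_⟩
  beta_reduce
  have := h.2 n (by omega) (m + 1)
  rw [ME] at this
  rw [show (m : ℤ) - n + 1 = ((m + 1 : ℕ) : ℤ) - n by push_cast; ring, ← this,
    ME, Module.End.mul_apply, derOp, Polynomial.coeff_derivative, Nat.factorial_succ]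
  push_cast; ring

lemma ASym_mul_of_mem {a : Module.End K (Polynomial K)} (ha : a ∈ I1 K) :
    ∀ b, (∃ c N, ASym K b c N) → ∃ c N, ASym K (a * b) c N := by
  induction ha using Algebra.adjoin_induction with
  | mem x hx =>
    rintro b ⟨c, N, h⟩
    rcases hx with rfl | rfl | rfl
    · exact ⟨_, _, h.x⟩
    · exact ⟨_, _, h.der⟩
    · exact ⟨_, _, h.int⟩
  | algebraMap r =>
    rintro b ⟨c, N, h⟩
    rw [← Algebra.smul_def]
    exact ⟨_, _, h.smul K r⟩
  | add x y _ _ hx hy =>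
    intro b hb
    obtain ⟨c, N, h⟩ := hx b hb
    obtain ⟨c', N', h'⟩ := hy b hb
    rw [add_mul]
    exact ⟨_, _, h.add K h'⟩
  | mul x y _ _ hx hy =>
    intro b hb
    rw [mul_assoc]
    exact hx _ (hy b hb)

lemma exists_ASym {a : Module.End K (Polynomial K)} (ha : a ∈ I1 K) : ∃ c N, ASym K a c N := by
  have := ASym_mul_of_mem K ha 1 ⟨_, _, ASym_one K⟩
  rwa [mul_one] at this

lemma ASym.ne_zero {a b : Module.End K (Polynomial K)} (hba : b * a = 1)
    {c : ℤ → Polynomial K} {N : ℕ} (h : ASym K a c N) : ∃ d, c d ≠ 0 := by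
  by_contra! hc
  have h1 : ME K (b * a) N N = 1 := by rw [hba, ME_one]; simp
  rw [ME_mul, Finset.sum_eq_zero] at h1
  · exact zero_ne_one h1
  · intro k _
    rw [h.2 N le_rfl, hc]; simp

lemma poly_eq_of_large {p q : Polynomial K} (N : ℕ)
    (h : ∀ n : ℕ, N ≤ n → p.eval (n : K) = q.eval (n : K)) : p = q := by
  refine Polynomial.eq_of_infinite_eval_eq p q ?_
  refine Set.Infinite.mono (s := (fun n : ℕ => (n : K)) '' Set.Ici N) ?_ ?_
  · rintro _ ⟨n, hn, rfl⟩
    exact h n hn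
  · exact (Set.Ici_infinite N).image (Nat.cast_injective.injOn)

/-- extreme coefficients multiply -/
lemma extreme {a b : Module.End K (Polynomial K)} (hab : a * b = 1)
    {c c' : ℤ → Polynomial K} {N N' : ℕ} (h : ASym K a c N) (h' : ASym K b c' N')
    (D E : ℤ) (hD : c D ≠ 0) (hE : c' E ≠ 0)
    (hx : ∀ e, c' e ≠ 0 → c (D + E - e) ≠ 0 → e = E) :
    D + E = 0 ∧ (c D).comp (Polynomial.X + Polynomial.C (E : K)) * c' E = 1 := by
  have hDN : D.natAbs ≤ N := by by_contra hh; exact hD (h.1 D (by omega))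
  have hEN : E.natAbs ≤ N' := by by_contra hh; exact hE (h'.1 E (by omega))
  have key : ∀ n : ℕ, 2 * N + 2 * N' ≤ n →
      ((c D).comp (Polynomial.X + Polynomial.C (E : K)) * c' E).eval (n : K) =
        (if D + E = 0 then (1 : Polynomial K) else 0).eval (n : K) := by
    intro n hn
    obtain ⟨k, hk⟩ : ∃ k : ℕ, (k : ℤ) = n + E := ⟨((n : ℤ) + E).toNat, by omega⟩
    obtain ⟨m, hm⟩ : ∃ m : ℕ, (m : ℤ) = n + D + E := ⟨((n : ℤ) + D + E).toNat, by omega⟩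
    have e1 := ME_mul_single K a b m n k (by
      intro l hl
      by_contra hne
      have hne1 := left_ne_zero_of_mul hne
      have hne2 := right_ne_zero_of_mul hne
      rw [h'.2 n (by omega)] at hne1
      have hc1 : c' ((l : ℤ) - n) ≠ 0 := fun h0 => hne1 (by rw [h0]; simp)
      have hl1 : ((l : ℤ) - n).natAbs ≤ N' := by by_contra hh; exact hc1 (h'.1 _ (by omega))
      rw [h.2 l (by omega)] at hne2
      have hc2 : c ((m : ℤ) - l) ≠ 0 := fun h0 => hne2 (by rw [h0]; simp)
      have := hx _ hc1 (by rwa [show D + E - ((l : ℤ) - n) = m - l by omega])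
      omega)
    rw [hab, ME_one, h'.2 n (by omega), h.2 k (by omega), show (k : ℤ) - n = E by omega,
      show (m : ℤ) - k = D by omega] at e1
    have hkK : (k : K) = n + (E : K) := by
      have := congrArg (Int.cast : ℤ → K) hk
      push_cast at this
      exact this
    rw [Polynomial.eval_mul, Polynomial.eval_comp, Polynomial.eval_add, Polynomial.eval_X,
      Polynomial.eval_C, ← hkK, mul_comm, ← e1]
    by_cases h0 : D + E = 0
    · rw [if_pos h0, if_pos (by omega)]; simp
    · rw [if_neg h0, if_neg (by omega)]; simp
  have hp := poly_eq_of_large K _ key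
  by_cases h0 : D + E = 0
  · rw [if_pos h0] at hp
    exact ⟨h0, hp⟩
  · rw [if_neg h0] at hp
    exfalso
    rcases mul_eq_zero.1 hp with h1 | h1
    · apply hD
      have := congrArg (fun q => q.comp (Polynomial.X - Polynomial.C (E : K))) h1
      simpa [Polynomial.comp_assoc] using this
    · exact hE h1

lemma exists_top {c : ℤ → Polynomial K} {N : ℕ} (h : ∀ d : ℤ, N < d.natAbs → c d = 0)
    (hne : ∃ d, c d ≠ 0) : ∃ D, c D ≠ 0 ∧ ∀ d, c d ≠ 0 → d ≤ D :=
  Int.exists_greatest_of_bdd ⟨N, fun z hz => by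
    by_contra hh; exact hz (h z (by omega))⟩ hne

lemma exists_bot {c : ℤ → Polynomial K} {N : ℕ} (h : ∀ d : ℤ, N < d.natAbs → c d = 0)
    (hne : ∃ d, c d ≠ 0) : ∃ D, c D ≠ 0 ∧ ∀ d, c d ≠ 0 → D ≤ d :=
  Int.exists_least_of_bdd ⟨-N, fun z hz => by
    by_contra hh; exact hz (h z (by omega))⟩ hne

lemma unit_structure {a b : Module.End K (Polynomial K)} (hab : a * b = 1) (hba : b * a = 1)
    {c c' : ℤ → Polynomial K} {N N' : ℕ} (h : ASym K a c N) (h' : ASym K b c' N') :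
    ∃ D : ℤ, ∃ r : K, r ≠ 0 ∧ c D = Polynomial.C r ∧ (∀ d, d ≠ D → c d = 0) ∧
      (∀ d, d ≠ -D → c' d = 0) := by
  obtain ⟨D, hD, hDm⟩ := exists_top K h.1 (h.ne_zero K hba)
  obtain ⟨E, hE, hEm⟩ := exists_top K h'.1 (h'.ne_zero K hab)
  obtain ⟨D', hD', hDm'⟩ := exists_bot K h.1 (h.ne_zero K hba)
  obtain ⟨E', hE', hEm'⟩ := exists_bot K h'.1 (h'.ne_zero K hab)
  obtain ⟨h1, h2⟩ := extreme K hab h h' D E hD hE (fun e he hc => by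
    have := hEm _ he
    have := hDm _ hc
    omega)
  obtain ⟨h3, -⟩ := extreme K hab h h' D' E' hD' hE' (fun e he hc => by
    have := hEm' _ he
    have := hDm' _ hc
    omega)
  have i1 := hDm _ hD'
  have i2 := hEm _ hE'
  have hu : IsUnit ((c D).comp (Polynomial.X + Polynomial.C (E : K))) := IsUnit.of_mul_eq_one _ h2
  have hdeg : (c D).natDegree = 0 := by
    have := Polynomial.natDegree_eq_zero_of_isUnit hu
    rw [Polynomial.natDegree_comp, Polynomial.natDegree_X_add_C, mul_one] at this
    exact this
  obtain ⟨r, hr⟩ := Polynomial.natDegree_eq_zero.1 hdeg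
  refine ⟨D, r, ?_, hr.symm, ?_, ?_⟩
  · rintro rfl; exact hD (by rw [← hr]; simp)
  · intro d hd
    by_contra hc
    have := hDm _ hc
    have := hDm' _ hc
    omega
  · intro d hd
    by_contra hc
    have := hEm _ hc
    have := hEm' _ hc
    omega

/-- truncation -/
def truncL (P : ℕ) : Polynomial K →ₗ[K] (Fin P → K) :=
  LinearMap.pi fun i => Polynomial.lcoeff K i

lemma truncL_surj (P : ℕ) : Function.Surjective (truncL K P) := by
  intro f
  refine ⟨∑ i : Fin P, Polynomial.monomial (i : ℕ) (f i), ?_⟩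
  ext j
  simp [truncL, Polynomial.finsetSum_coeff, Polynomial.coeff_monomial, Fin.val_inj]

lemma mem_ker_truncL (P : ℕ) (p : Polynomial K) :
    p ∈ LinearMap.ker (truncL K P) ↔ ∀ k < P, p.coeff k = 0 := by
  rw [LinearMap.mem_ker, funext_iff]
  constructor
  · intro h k hk; exact h ⟨k, hk⟩
  · intro h k; exact h k k.2

lemma map_ker {a : Module.End K (Polynomial K)} {P Q : ℕ}
    (h : ∀ n, P ≤ n → ∀ m, m < Q → ME K a m n = 0) {p : Polynomial K}
    (hp : p ∈ LinearMap.ker (truncL K P)) : a p ∈ LinearMap.ker (truncL K Q) := by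
  rw [mem_ker_truncL] at *
  intro m hm
  have := coeff_apply_eq K a p m
  rw [Finset.sum_eq_zero] at this
  · exact (mul_eq_zero.1 this).resolve_left (fact_ne K m)
  · intro k hk
    by_cases hkP : k < P
    · simp [hp k hkP]
    · rw [h k (by omega) m hm, mul_zero]

lemma index_zero {a b : Module.End K (Polynomial K)} (hab : a * b = 1) (hba : b * a = 1)
    {P Q : ℕ} (ha : ∀ n, P ≤ n → ∀ m, m < Q → ME K a m n = 0)
    (hb : ∀ n, Q ≤ n → ∀ m, m < P → ME K b m n = 0) : P = Q := by
  have hker : LinearMap.ker (truncL K P) = LinearMap.ker ((truncL K Q).comp a) := by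
    ext p
    constructor
    · intro hp
      have := map_ker K ha hp
      exact this
    · intro hp
      have hp' : a p ∈ LinearMap.ker (truncL K Q) := hp
      have := map_ker K hb hp'
      rwa [← Module.End.mul_apply, hba] at this
  have hs : Function.Surjective ((truncL K Q).comp a) := by
    refine (truncL_surj K Q).comp fun y => ⟨b y, ?_⟩
    exact LinearMap.congr_fun hab y
  have e1 := (LinearMap.quotKerEquivOfSurjective _ (truncL_surj K P)).finrank_eq
  have e2 := (LinearMap.quotKerEquivOfSurjective _ hs).finrank_eq
  rw [← hker, e1] at e2
  simpa using e2

lemma unit_mem {a b : Module.End K (Polynomial K)} (ha : a ∈ I1 K) (hb : b ∈ I1 K)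
    (hab : a * b = 1) (hba : b * a = 1) : ∃ r : K, r ≠ 0 ∧ a - r • 1 ∈ Fspan K := by
  obtain ⟨c, N, h⟩ := exists_ASym K ha
  obtain ⟨c', N', h'⟩ := exists_ASym K hb
  obtain ⟨D, r, hr, hcD, hc, hc'⟩ := unit_structure K hab hba h h'
  obtain ⟨Q, hQ⟩ : ∃ Q : ℕ, (Q : ℤ) = (N + N' + D.natAbs : ℕ) + D :=
    ⟨((N + N' + D.natAbs : ℕ) + D).toNat, by omega⟩
  have hPQ : N + N' + D.natAbs = Q := by
    refine index_zero K hab hba ?_ ?_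
    · intro n hn m hm
      rw [h.2 n (by omega), hc _ (by omega)]; simp
    · intro n hn m hm
      rw [h'.2 n (by omega), hc' _ (by omega)]; simp
    
  have hD0 : D = 0 := by omega
  subst hD0
  refine ⟨r, hr, mem_Fspan_of K _ N fun n hn => ?_⟩
  rw [apply_xd_eq]
  refine Finset.sum_eq_zero fun m _ => ?_
  rw [ME_sub, ME_smul, ME_one, h.2 n hn]
  by_cases hmn : m = n
  · subst hmn
    simp [hcD]
  · rw [hc _ (by omega)]; simp [hmn]

lemma central {a : Module.End K (Polynomial K)} (hx : a * xOp K = xOp K * a)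
    (hd : a * derOp K = derOp K * a) : ∃ r : K, a = r • 1 := by
  have hx' : ∀ p, a (Polynomial.X * p) = Polynomial.X * a p := fun p => LinearMap.congr_fun hx p
  have hd' : Polynomial.derivative (a 1) = 0 := by
    have := LinearMap.congr_fun hd (1 : Polynomial K)
    simp only [Module.End.mul_apply, derOp, Polynomial.derivative_one, map_zero] at this
    exact this.symm
  obtain ⟨r, hr⟩ := Polynomial.natDegree_eq_zero.1
    (Polynomial.natDegree_eq_zero_of_derivative_eq_zero hd')
  refine ⟨r, ?_⟩
  have hpow : ∀ n : ℕ, a (Polynomial.X ^ n) = r • Polynomial.X ^ n := by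
    intro n
    induction n with
    | zero => rw [pow_zero, ← hr, Polynomial.smul_eq_C_mul, mul_one]
    | succ n ih => rw [pow_succ', hx', ih, mul_smul_comm]
  refine LinearMap.ext fun p => ?_
  induction p using Polynomial.induction_on' with
  | add p q hp hq => rw [map_add, map_add, hp, hq]
  | monomial n s =>
    rw [← Polynomial.C_mul_X_pow_eq_monomial, ← Polynomial.smul_eq_C_mul, map_smul, map_smul, hpow]
    rfl

lemma smul_one_mem_Fspan {r : K} (h : (r • 1 : Module.End K (Polynomial K)) ∈ Fspan K) :
    r = 0 := by
  obtain ⟨N, hN⟩ := of_mem_Fspan K h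
  have := hN N le_rfl
  have h2 := congrArg (fun p => Polynomial.coeff p N) this
  simp [xd_coeff] at h2
  exact h2.resolve_right N.factorial_ne_zero

lemma innerAut_apply (u : (I1 K)ˣ) (a : I1 K) : innerAut K u a = ↑u * a * ↑u⁻¹ := rfl

/-- The map `u ↦ ω_u` is an injective group homomorphism from
`(1+F)* = {units u of I₁ : u - 1 ∈ F}` to the group of `K`-algebra automorphisms of
`I₁`, whose image is exactly the set of all inner automorphisms of `I₁`. -/
theorem innerAut_injective_hom_image_eq_inner :
    (∀ u v : (I1 K)ˣ,
        ((u : I1 K) : Module.End K (Polynomial K)) - 1 ∈ Fspan K →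
        ((v : I1 K) : Module.End K (Polynomial K)) - 1 ∈ Fspan K →
        innerAut K u = innerAut K v → u = v) ∧
    (∀ u v : (I1 K)ˣ, innerAut K (u * v) = (innerAut K v).trans (innerAut K u)) ∧
    (∀ w : (I1 K)ˣ, ∃ u : (I1 K)ˣ,
        ((u : I1 K) : Module.End K (Polynomial K)) - 1 ∈ Fspan K ∧
        innerAut K w = innerAut K u) := by
  refine ⟨?_, ?_, ?_⟩
  · intro u v hu hv huv
    have hc : ∀ a : I1 K, (↑(v⁻¹ * u) : I1 K) * a = a * ↑(v⁻¹ * u) := by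
      intro a
      have h1 := congrArg (fun f : I1 K ≃ₐ[K] I1 K => f a) huv
      simp only [innerAut_apply] at h1
      have h2 : (↑v⁻¹ : I1 K) * (↑u * a * ↑u⁻¹) * ↑u = ↑v⁻¹ * (↑v * a * ↑v⁻¹) * ↑u := by rw [h1]
      rw [Units.val_mul]
      simpa only [mul_assoc, Units.inv_mul, mul_one, Units.inv_mul_cancel_left] using h2
    obtain ⟨r, hr⟩ := central K (a := ((↑(v⁻¹ * u) : I1 K) : Module.End K (Polynomial K)))
      (congrArg Subtype.val (hc ⟨xOp K, xOp_mem K⟩))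
      (congrArg Subtype.val (hc ⟨derOp K, derOp_mem K⟩))
    have hw : (↑(v⁻¹ * u) : I1 K) = r • 1 := Subtype.ext hr
    have huv' : (u : I1 K) = r • (v : I1 K) := by
      have : (u : I1 K) = ↑v * ↑(v⁻¹ * u) := by
        rw [Units.val_mul, Units.mul_inv_cancel_left]
      rw [this, hw, mul_smul_comm, mul_one]
    have h3 : ((u : I1 K) : Module.End K (Polynomial K)) =
      r • ((v : I1 K) : Module.End K (Polynomial K)) := congrArg Subtype.val huv'
    have h4 : ((r - 1) • 1 : Module.End K (Polynomial K)) ∈ Fspan K := by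
      have := (Fspan K).sub_mem hu ((Fspan K).smul_mem r hv)
      rw [h3] at this
      convert this using 1
      module
    have h5 : r = 1 := sub_eq_zero.1 (smul_one_mem_Fspan K h4)
    rw [h5, one_smul] at huv'
    exact Units.ext huv'
  · intro u v
    refine AlgEquiv.ext fun a => ?_
    rw [AlgEquiv.trans_apply, innerAut_apply, innerAut_apply, innerAut_apply, mul_inv_rev,
      Units.val_mul, Units.val_mul]
    simp only [mul_assoc]
  · intro w
    obtain ⟨r, hr, hF⟩ := unit_mem K (w : I1 K).2 (↑w⁻¹ : I1 K).2
      (congrArg Subtype.val w.mul_inv) (congrArg Subtype.val w.inv_mul)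
    refine ⟨⟨r⁻¹ • (w : I1 K), r • (↑w⁻¹ : I1 K), ?_, ?_⟩, ?_, ?_⟩
    · rw [smul_mul_smul_comm, Units.mul_inv, inv_mul_cancel₀ hr, one_smul]
    · rw [smul_mul_smul_comm, Units.inv_mul, mul_inv_cancel₀ hr, one_smul]
    · have := (Fspan K).smul_mem r⁻¹ hF
      rw [smul_sub, smul_smul, inv_mul_cancel₀ hr, one_smul] at this
      exact this
    · refine AlgEquiv.ext fun a => ?_
      rw [innerAut_apply, innerAut_apply]
      change _ = (r⁻¹ • (w : I1 K)) * a * (r • (↑w⁻¹ : I1 K))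
      rw [smul_mul_assoc, smul_mul_smul_comm, inv_mul_cancel₀ hr, one_smul]

end
end
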